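/- arXiv:2103.05799 — 5 statements merged into one kernel-verified Lean document; each statement's English description precedes it below -/
import Mathlib

section
/- Let (X_n(t,s), n ≥ 1) be a sequence of random functions on [0,1]^2 such that, for every n and almost every sample point, (t,s) ↦ X_n(t,s) is non-decreasing in t and non-increasing in s. Let a : [0,1]^2 → ℝ be a continuous function which is non-decreasing in t and non-increasing in s. If for every (t,s) ∈ [0,1]^2 one has X_n(t,s) → a(t,s) almost surely as n → ∞, then sup_{0 ≤ t ≤ 1} |X_n(t,t) − a(t,t)| → 0 almost surely as n → ∞. -/
open MeasureTheory Filter Topology CategoryTheory AlgebraicTopology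
open scoped InnerProductSpace ENNReal NNReal

noncomputable section

def ballsAround {d : ℕ} (Y : Set (EuclideanSpace ℝ (Fin d))) (r : ℝ) :
    Set (EuclideanSpace ℝ (Fin d)) :=
  ⋃ y ∈ Y, Metric.ball y r

def cechBody {d : ℕ} (Y : Set (EuclideanSpace ℝ (Fin d))) (t : ℝ) :
    Set (EuclideanSpace ℝ (Fin d)) :=
  ballsAround Y (t / 2)

def cechConnected {d : ℕ} (Y : Set (EuclideanSpace ℝ (Fin d))) (t : ℝ) : Prop :=
  IsConnected (cechBody Y t)

def singularChainComplexQ (X : TopCat) : ChainComplex (ModuleCat ℚ) ℕ :=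
  (alternatingFaceMapComplex (ModuleCat ℚ)).obj
    (((SimplicialObject.whiskering _ _).obj (ModuleCat.free ℚ)).obj (TopCat.toSSet.obj X))

def bettiTop (X : TopCat) (k : ℕ) : ℕ :=
  Module.finrank ℚ ((singularChainComplexQ X).homology k)

def cechBetti {d : ℕ} (Y : Set (EuclideanSpace ℝ (Fin d))) (t : ℝ) (k : ℕ) : ℕ :=
  bettiTop (TopCat.of (cechBody Y t)) k

/-- `h_t^{(i,j)}(0, y₁, …, y_{m})` as a proposition: the Čech complex on the point set
`{0, y₁, …, y_m}` with parameter `t` is connected and its `k`-th Betti number is `j`. -/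
def hProp {d : ℕ} (k : ℕ) (t : ℝ) (j : ℕ) {m : ℕ}
    (y : Fin m → EuclideanSpace ℝ (Fin d)) : Prop :=
  cechConnected (insert 0 (Set.range y)) t ∧ cechBetti (insert 0 (Set.range y)) t k = j

/-- The random point set `{X_1(ω), …, X_n(ω)}`. -/
def pointCloud {Ω : Type*} {d : ℕ} (X : ℕ → Ω → EuclideanSpace ℝ (Fin d)) (n : ℕ) (ω : Ω) :
    Set (EuclideanSpace ℝ (Fin d)) :=
  {p | ∃ i < n, X i ω = p}

/-- The Betti number process `β_{k,n}(t)`: the `k`-th Betti number of the Čech complex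
with parameter `t` built over the points of `{X_1,…,X_n}` lying at distance at least
`R_n` from the origin. -/
def betaProcess {Ω : Type*} {d : ℕ} (X : ℕ → Ω → EuclideanSpace ℝ (Fin d)) (R : ℕ → ℝ)
    (k n : ℕ) (t : ℝ) (ω : Ω) : ℕ :=
  cechBetti {p ∈ pointCloud X n ω | R n ≤ ‖p‖} t k

/-- `ω_d`, the volume of the unit ball in `ℝ^d`. -/
def unitBallVol (d : ℕ) : ℝ :=
  (volume (Metric.ball (0 : EuclideanSpace ℝ (Fin d)) 1)).toReal

/-- `s_{d-1}`, the surface area of the unit sphere in `ℝ^d`. -/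
def sphereSurf (d : ℕ) : ℝ := d * unitBallVol d

/-- `μ_k^{(k+2,1)}(t;0)`. -/
def muSimple (d k : ℕ) (α t : ℝ) : ℝ :=
  sphereSurf d / (α * (k + 2) - d) *
    (volume {y : Fin (k + 1) → EuclideanSpace ℝ (Fin d) | hProp k t 1 y}).toReal

open Classical in
/-- `μ_k^{(i,j)}(t;λ)`. -/
def muGen (d k : ℕ) (α : ℝ) (i j : ℕ) (t lam : ℝ) : ℝ :=
  sphereSurf d * ∫ ρ in Set.Ioi (1 : ℝ),
    ρ ^ ((d : ℝ) - 1 - α * i) *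
      ∫ y : Fin (i - 1) → EuclideanSpace ℝ (Fin d),
        if hProp k t j y then
          Real.exp (-(lam * ρ ^ (-α) * t ^ d *
            (volume (ballsAround (insert 0 (Set.range y)) 1)).toReal))
        else 0

/-- The number of `i`-point subsets `Y` of `A` such that `Č(Y,t)` is connected, has `k`-th
Betti number `j`, and is a connected component of `Č(A,t)`. -/
def Jcount {d : ℕ} (k : ℕ) (A : Set (EuclideanSpace ℝ (Fin d))) (t : ℝ) (i j : ℕ) : ℕ :=
  Set.ncard {Y : Finset (EuclideanSpace ℝ (Fin d)) |
    (Y : Set (EuclideanSpace ℝ (Fin d))) ⊆ A ∧ Y.card = i ∧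
      cechConnected (Y : Set (EuclideanSpace ℝ (Fin d))) t ∧
      cechBetti (Y : Set (EuclideanSpace ℝ (Fin d))) t k = j ∧
      Disjoint (cechBody (Y : Set (EuclideanSpace ℝ (Fin d))) t)
        (cechBody (A \ (Y : Set (EuclideanSpace ℝ (Fin d)))) t)}

/-- The number of `i`-point subsets `Y` of `A` such that `Č(Y,t)` is connected. -/
def Lcount {d : ℕ} (A : Set (EuclideanSpace ℝ (Fin d))) (t : ℝ) (i : ℕ) : ℕ :=
  Set.ncard {Y : Finset (EuclideanSpace ℝ (Fin d)) |
    (Y : Set (EuclideanSpace ℝ (Fin d))) ⊆ A ∧ Y.card = i ∧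
      cechConnected (Y : Set (EuclideanSpace ℝ (Fin d))) t}

/-- The left-continuous generalized inverse `ψ^←(x) = inf {y ≥ 0 : ψ(y) ≥ x}`. -/
def psiInv (ψ : ℝ → ℝ) (x : ℝ) : ℝ := sInf {y : ℝ | 0 ≤ y ∧ x ≤ ψ y}

/-- The surface measure on the unit sphere of `ℝ^d` (total mass `s_{d-1} = d ω_d`). -/
def sphereMeasure (d : ℕ) : Measure (Metric.sphere (0 : EuclideanSpace ℝ (Fin d)) 1) :=
  (volume : Measure (EuclideanSpace ℝ (Fin d))).toSphere

open Classical in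
/-- `ξ_k^{(i,j)}(t;λ)`, with `cinv = c⁻¹ ∈ [0,∞)`. -/
def xiGen (d k : ℕ) (cinv : ℝ) (i j : ℕ) (t lam : ℝ) : ℝ :=
  ∫ θ : Metric.sphere (0 : EuclideanSpace ℝ (Fin d)) 1,
    (∫ ρ in Set.Ioi (0 : ℝ),
      (∫ y : Fin (i - 1) → EuclideanSpace ℝ (Fin d),
        if hProp k t j y ∧ ∀ ℓ, 0 ≤ ρ + cinv * ⟪(θ : EuclideanSpace ℝ (Fin d)), y ℓ⟫_ℝ then
          Real.exp (-(ρ * i) - cinv * ∑ ℓ, ⟪(θ : EuclideanSpace ℝ (Fin d)), y ℓ⟫_ℝ) *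
            Real.exp (-(lam * Real.exp (-ρ) *
              ∫ z in ballsAround (insert 0 (Set.range y)) t,
                Real.exp (-(cinv * ⟪(θ : EuclideanSpace ℝ (Fin d)), z⟫_ℝ))))
        else 0))
    ∂(sphereMeasure d)

/-- `ξ_k^{(k+2,1)}(t;0)`. -/
def xiSimple (d k : ℕ) (cinv : ℝ) (t : ℝ) : ℝ := xiGen d k cinv (k + 2) 1 t 0


open Classical in
/-- `ζ'_i(t)`: the limiting constant in the exponential-tail connectivity lemma. -/
def zetaExp (d : ℕ) (cinv : ℝ) (i : ℕ) (t : ℝ) : ℝ :=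
  ∫ θ : Metric.sphere (0 : EuclideanSpace ℝ (Fin d)) 1,
    (∫ ρ in Set.Ioi (0 : ℝ),
      (∫ y : Fin (i - 1) → EuclideanSpace ℝ (Fin d),
        if cechConnected (insert 0 (Set.range y)) t ∧
            ∀ ℓ, 0 ≤ ρ + cinv * ⟪(θ : EuclideanSpace ℝ (Fin d)), y ℓ⟫_ℝ then
          Real.exp (-(ρ * i) - cinv * ∑ ℓ, ⟪(θ : EuclideanSpace ℝ (Fin d)), y ℓ⟫_ℝ)
        else 0))
  ∂(sphereMeasure d)

/-- `ζ_i(t)`: the limiting constant in the heavy-tail connectivity lemma. -/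
def zetaHeavy (d : ℕ) (α : ℝ) (i : ℕ) (t : ℝ) : ℝ :=
  sphereSurf d / (α * i - d) *
    (volume {y : Fin (i - 1) → EuclideanSpace ℝ (Fin d) |
      cechConnected (insert 0 (Set.range y)) t}).toReal

end


/-- If functions monotone in the first and antitone in the second variable converge pointwise on
all the grids of mesh `1 / (N + 1)` to a function continuous on the unit square, then they converge
uniformly on the diagonal. -/
theorem tendsto_iSup_abs_sub_diagonal_of_monotone_antitone
    {f : ℕ → ℝ → ℝ → ℝ} {a : ℝ → ℝ → ℝ}
    (hmono : ∀ n, ∀ s ∈ Set.Icc (0:ℝ) 1, MonotoneOn (fun t => f n t s) (Set.Icc 0 1))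
    (hanti : ∀ n, ∀ t ∈ Set.Icc (0:ℝ) 1, AntitoneOn (fun s => f n t s) (Set.Icc 0 1))
    (hcont : ContinuousOn (fun p : ℝ × ℝ => a p.1 p.2) (Set.Icc 0 1 ×ˢ Set.Icc 0 1))
    (hlim : ∀ N i j : ℕ, i ≤ N + 1 → j ≤ N + 1 →
      Tendsto (fun n => f n ((i : ℝ) / (N + 1)) ((j : ℝ) / (N + 1))) atTop
        (𝓝 (a ((i : ℝ) / (N + 1)) ((j : ℝ) / (N + 1))))) :
    Tendsto (fun n => ⨆ t : Set.Icc (0:ℝ) 1, |f n (t : ℝ) (t : ℝ) - a (t : ℝ) (t : ℝ)|)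
      atTop (𝓝 0) := by
  have huc := (isCompact_Icc.prod isCompact_Icc).uniformContinuousOn_of_continuous hcont
  rw [Metric.uniformContinuousOn_iff] at huc
  rw [Metric.tendsto_atTop']
  intro ε hε
  obtain ⟨δ, hδ, hclose⟩ := huc (ε / 4) (by positivity)
  obtain ⟨N, hN⟩ := exists_nat_one_div_lt hδ
  have hpos : (0:ℝ) < N + 1 := by positivity
  have hev : ∀ᶠ n in atTop, ∀ i ∈ Finset.range (N + 2), ∀ j ∈ Finset.range (N + 2),
      dist (f n ((i : ℝ) / (N + 1)) ((j : ℝ) / (N + 1)))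
        (a ((i : ℝ) / (N + 1)) ((j : ℝ) / (N + 1))) < ε / 4 := by
    simp only [Filter.eventually_all_finset]
    intro i hi j hj
    rw [Finset.mem_range] at hi hj
    exact (hlim N i j (by omega) (by omega)).eventually (Metric.ball_mem_nhds _ (by positivity))
  obtain ⟨M, hM⟩ := eventually_atTop.1 hev
  refine ⟨M, fun n hn => ?_⟩
  have hgrid := hM n hn.le
  have hbound : ∀ t : Set.Icc (0:ℝ) 1, |f n (t : ℝ) (t : ℝ) - a (t : ℝ) (t : ℝ)| ≤ ε / 2 := by
    rintro ⟨t, ht⟩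
    have ht0 : 0 ≤ t * (N + 1) := mul_nonneg ht.1 hpos.le
    have htN : t * (N + 1) ≤ ((N + 1 : ℕ) : ℝ) := by
      push_cast
      exact mul_le_of_le_one_left hpos.le ht.2
    set i := ⌊t * (N + 1)⌋₊
    set j := ⌈t * (N + 1)⌉₊
    have hj : j ≤ N + 1 := Nat.ceil_le.2 htN
    have hi : i ≤ N + 1 := (Nat.floor_le_ceil _).trans hj
    set u : ℝ := (i : ℝ) / (N + 1) with hu_def
    set v : ℝ := (j : ℝ) / (N + 1) with hv_def
    have hut : u ≤ t := (div_le_iff₀ hpos).2 (Nat.floor_le ht0)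
    have htv : t ≤ v := (le_div_iff₀ hpos).2 (Nat.le_ceil _)
    have htu : t - u < δ := by
      refine lt_of_le_of_lt ?_ hN
      rw [sub_le_iff_le_add, hu_def, ← add_div, le_div_iff₀ hpos, add_comm (1:ℝ) (i:ℝ)]
      exact (Nat.lt_floor_add_one (t * (N + 1))).le
    have hvt : v - t < δ := by
      refine lt_of_le_of_lt ?_ hN
      rw [sub_le_iff_le_add, hv_def, div_le_iff₀ hpos, add_mul, one_div_mul_cancel hpos.ne',
        add_comm]
      exact (Nat.ceil_lt_add_one ht0).le
    have hu : u ∈ Set.Icc (0:ℝ) 1 := ⟨by positivity, hut.trans ht.2⟩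
    have hv : v ∈ Set.Icc (0:ℝ) 1 := by
      refine ⟨by positivity, (div_le_one hpos).2 ?_⟩
      exact_mod_cast hj
    have hdu : dist u t < δ := by
      rw [Real.dist_eq, abs_sub_comm, abs_of_nonneg (sub_nonneg.2 hut)]; exact htu
    have hdv : dist v t < δ := by
      rw [Real.dist_eq, abs_of_nonneg (sub_nonneg.2 htv)]; exact hvt
    have hvu := hclose (v, u) ⟨hv, hu⟩ (t, t) ⟨ht, ht⟩ (max_lt hdv hdu)
    have huv := hclose (u, v) ⟨hu, hv⟩ (t, t) ⟨ht, ht⟩ (max_lt hdu hdv)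
    have hi' : i ∈ Finset.range (N + 2) := Finset.mem_range.2 (by omega)
    have hj' : j ∈ Finset.range (N + 2) := Finset.mem_range.2 (by omega)
    have gvu := hgrid j hj' i hi'
    have guv := hgrid i hi' j hj'
    rw [← hu_def, ← hv_def] at gvu guv
    rw [Real.dist_eq, abs_lt] at hvu huv gvu guv
    have hupper : f n t t ≤ f n v u :=
      (hmono n t ht ht hv htv).trans (hanti n v hv hu ht hut)
    have hlower : f n u v ≤ f n t t :=
      (hanti n u hu ht hv htv).trans (hmono n t ht hu ht hut)
    dsimp only at hvu huv ⊢
    rw [abs_le]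
    constructor <;> linarith [hvu.2, huv.1, gvu.2, guv.1]
  rw [Real.dist_0_eq_abs, abs_of_nonneg (Real.iSup_nonneg fun _ => abs_nonneg _)]
  exact (ciSup_le hbound).trans_lt (by linarith)

/-- Functional SLLN from pointwise SLLN for two-parameter processes that are monotone in
each coordinate (Lemma `pointwise.to.funcl (ii)`). -/
theorem stmt6 {Ω : Type*} [MeasureSpace Ω] [IsProbabilityMeasure (volume : Measure Ω)]
    (X : ℕ → Ω → ℝ → ℝ → ℝ) (a : ℝ → ℝ → ℝ)
    (hXmono : ∀ n, ∀ᵐ ω ∂(volume : Measure Ω),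
      (∀ s ∈ Set.Icc (0:ℝ) 1, MonotoneOn (fun t => X n ω t s) (Set.Icc 0 1)) ∧
      (∀ t ∈ Set.Icc (0:ℝ) 1, AntitoneOn (fun s => X n ω t s) (Set.Icc 0 1)))
    (hacont : ContinuousOn (fun p : ℝ × ℝ => a p.1 p.2) (Set.Icc 0 1 ×ˢ Set.Icc 0 1))
    (hamono : ∀ s ∈ Set.Icc (0:ℝ) 1, MonotoneOn (fun t => a t s) (Set.Icc 0 1))
    (haanti : ∀ t ∈ Set.Icc (0:ℝ) 1, AntitoneOn (fun s => a t s) (Set.Icc 0 1))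
    (hptwise : ∀ t ∈ Set.Icc (0:ℝ) 1, ∀ s ∈ Set.Icc (0:ℝ) 1,
      ∀ᵐ ω ∂(volume : Measure Ω), Tendsto (fun n => X n ω t s) atTop (𝓝 (a t s))) :
    ∀ᵐ ω ∂(volume : Measure Ω),
      Tendsto (fun n => ⨆ t : Set.Icc (0:ℝ) 1, |X n ω (t : ℝ) (t : ℝ) - a (t : ℝ) (t : ℝ)|)
        atTop (𝓝 0) := by
  have hgrid : ∀ᵐ ω ∂(volume : Measure Ω), ∀ N i j : ℕ, i ≤ N + 1 → j ≤ N + 1 →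
      Tendsto (fun n => X n ω ((i : ℝ) / (N + 1)) ((j : ℝ) / (N + 1))) atTop
        (𝓝 (a ((i : ℝ) / (N + 1)) ((j : ℝ) / (N + 1)))) := by
    simp only [ae_all_iff]
    intro N i j hi hj
    have hmem : ∀ k : ℕ, k ≤ N + 1 → (k : ℝ) / (N + 1) ∈ Set.Icc (0:ℝ) 1 := fun k hk =>
      ⟨by positivity, (div_le_one (by positivity)).2 (by exact_mod_cast hk)⟩
    exact hptwise _ (hmem i hi) _ (hmem j hj)
  filter_upwards [ae_all_iff.2 hXmono, hgrid] with ω hω hlim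
  exact tendsto_iSup_abs_sub_diagonal_of_monotone_antitone
    (fun n => (hω n).1) (fun n => (hω n).2) hacont hlim
end

section
/- Let d ≥ 2 and k ∈ {1,…,d−1}. Let X ⊂ ℝ^d be a finite set, let R > 0, set X' := {x ∈ X : ‖x‖ ≥ R}, and fix t ∈ [0,1] with t > 0. Define J(t) as the number of (k+2)-point subsets Y ⊆ X' such that Č(Y,t) is connected, β_k(Č(Y,t)) = 1, and Č(Y,t) is a connected component of Č(X',t); and define L(t) as the number of (k+3)-point subsets Y ⊆ X' such that Č(Y,t) is connected. Then J(t) ≤ β_k(Č(X',t)) ≤ J(t) + binom(k+3, k+1) · L(t). -/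
open MeasureTheory Filter Topology CategoryTheory AlgebraicTopology
open scoped InnerProductSpace ENNReal NNReal

noncomputable section

namespace CechBound

/-! ### Chains on tuples of points -/

/-- Rational chains on `n`-tuples of points of `V`. -/
abbrev TupleChain (V : Type*) (n : ℕ) : Type _ := (Fin n → V) →₀ ℚ

/-- The alternating-sum boundary of tuple chains. -/
def tupleBoundary (V : Type*) (n : ℕ) : TupleChain V (n + 1) →ₗ[ℚ] TupleChain V n :=
  Finsupp.linearCombination ℚ fun v : Fin (n + 1) → V =>
    ∑ i : Fin (n + 1), Finsupp.single (v ∘ i.succAbove) ((-1 : ℚ) ^ (i : ℕ))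

/-- The cone of tuple chains with apex `b`. -/
def tupleCone {V : Type*} (n : ℕ) (b : V) : TupleChain V n →ₗ[ℚ] TupleChain V (n + 1) :=
  Finsupp.lmapDomain ℚ ℚ fun v => (Fin.cons b v : Fin (n + 1) → V)

section Tuple

variable {V V' : Type*} {n : ℕ}

lemma tupleBoundary_single (v : Fin (n + 1) → V) :
    tupleBoundary V n (Finsupp.single v 1) =
      ∑ i : Fin (n + 1), Finsupp.single (v ∘ i.succAbove) ((-1 : ℚ) ^ (i : ℕ)) := by
  simp [tupleBoundary]

lemma tupleCone_single (b : V) (v : Fin n → V) (q : ℚ) :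
    tupleCone n b (Finsupp.single v q) = Finsupp.single (Fin.cons b v : Fin (n + 1) → V) q := by
  simp [tupleCone]

lemma cons_comp_succ_succAbove (b : V) (v : Fin (n + 1) → V) (i : Fin (n + 1)) :
    (Fin.cons b v : Fin (n + 2) → V) ∘ i.succ.succAbove =
      Fin.cons b (v ∘ i.succAbove) := by
  funext j
  refine Fin.cases ?_ (fun j => ?_) j <;> simp

lemma cons_comp_zero_succAbove (b : V) (v : Fin n → V) :
    (Fin.cons b v : Fin (n + 1) → V) ∘ (0 : Fin (n + 1)).succAbove = v := by
  funext j; simp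

lemma tupleBoundary_tupleCone_zero (b : V) (c : TupleChain V 0) :
    tupleBoundary V 0 (tupleCone 0 b c) = c := by
  suffices h : tupleBoundary V 0 ∘ₗ tupleCone 0 b = LinearMap.id from LinearMap.congr_fun h c
  refine Finsupp.lhom_ext' fun v => LinearMap.ext_ring ?_
  simp [tupleCone_single, tupleBoundary_single, Subsingleton.elim _ v]

lemma tupleBoundary_tupleCone (b : V) (c : TupleChain V (n + 1)) :
    tupleBoundary V (n + 1) (tupleCone (n + 1) b c) = c - tupleCone n b (tupleBoundary V n c) := by
  suffices h : tupleBoundary V (n + 1) ∘ₗ tupleCone (n + 1) b =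
      LinearMap.id - tupleCone n b ∘ₗ tupleBoundary V n from LinearMap.congr_fun h c
  refine Finsupp.lhom_ext' fun v => LinearMap.ext_ring ?_
  simp only [LinearMap.comp_apply, Finsupp.lsingle_apply, LinearMap.sub_apply, LinearMap.id_apply,
    tupleCone_single, tupleBoundary_single, map_sum]
  rw [Fin.sum_univ_succ]
  simp only [cons_comp_succ_succAbove, cons_comp_zero_succAbove, Fin.val_succ, pow_succ,
    Fin.val_zero, pow_zero, mul_neg, mul_one, Finsupp.single_neg, Finset.sum_neg_distrib]
  exact (sub_eq_add_neg _ _).symm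

lemma tupleBoundary_tupleBoundary : ∀ (n : ℕ) (c : TupleChain V (n + 2)),
    tupleBoundary V n (tupleBoundary V (n + 1) c) = 0 := by
  intro n
  induction n with
  | zero =>
    intro c
    suffices h : tupleBoundary V 0 ∘ₗ tupleBoundary V 1 = 0 from LinearMap.congr_fun h c
    refine Finsupp.lhom_ext' fun v => LinearMap.ext_ring ?_
    rw [← Fin.cons_self_tail v]
    simp only [LinearMap.comp_apply, Finsupp.lsingle_apply, LinearMap.zero_apply]
    rw [← tupleCone_single, tupleBoundary_tupleCone, map_sub,
      tupleBoundary_tupleCone_zero, sub_self]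
  | succ n ih =>
    intro c
    suffices h : tupleBoundary V (n + 1) ∘ₗ tupleBoundary V (n + 2) = 0 from LinearMap.congr_fun h c
    refine Finsupp.lhom_ext' fun v => LinearMap.ext_ring ?_
    rw [← Fin.cons_self_tail v]
    simp only [LinearMap.comp_apply, Finsupp.lsingle_apply, LinearMap.zero_apply]
    rw [← tupleCone_single, tupleBoundary_tupleCone, map_sub, tupleBoundary_tupleCone, ih]
    simp

/-- The subdivision operator associated with a choice `b` of an interior point for each tuple. -/
def tupleSd (b : ∀ n, (Fin (n + 1) → V) → V) : ∀ n, TupleChain V n →ₗ[ℚ] TupleChain V n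
  | 0 => LinearMap.id
  | n + 1 => Finsupp.linearCombination ℚ fun v : Fin (n + 1) → V =>
      tupleCone n (b n v) (tupleSd b n (tupleBoundary V n (Finsupp.single v 1)))

/-- The chain homotopy between the identity and the subdivision operator. -/
def tupleHtpy (b : ∀ n, (Fin (n + 1) → V) → V) : ∀ n, TupleChain V n →ₗ[ℚ] TupleChain V (n + 1)
  | 0 => 0
  | n + 1 => Finsupp.linearCombination ℚ fun v : Fin (n + 1) → V =>
      tupleCone (n + 1) (b n v)
        (Finsupp.single v 1 - tupleHtpy b n (tupleBoundary V n (Finsupp.single v 1)))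

lemma tupleSd_succ_single (b : ∀ n, (Fin (n + 1) → V) → V) (v : Fin (n + 1) → V) :
    tupleSd b (n + 1) (Finsupp.single v 1) =
      tupleCone n (b n v) (tupleSd b n (tupleBoundary V n (Finsupp.single v 1))) := by
  simp [tupleSd]

lemma tupleHtpy_succ_single (b : ∀ n, (Fin (n + 1) → V) → V) (v : Fin (n + 1) → V) :
    tupleHtpy b (n + 1) (Finsupp.single v 1) = tupleCone (n + 1) (b n v)
        (Finsupp.single v 1 - tupleHtpy b n (tupleBoundary V n (Finsupp.single v 1))) := by
  simp [tupleHtpy]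

lemma tupleBoundary_tupleHtpy (b : ∀ n, (Fin (n + 1) → V) → V) : ∀ (n : ℕ)
    (c : TupleChain V (n + 1)), tupleBoundary V (n + 1) (tupleHtpy b (n + 1) c) +
      tupleHtpy b n (tupleBoundary V n c) = c - tupleSd b (n + 1) c := by
  intro n
  induction n with
  | zero =>
    intro c
    suffices h : tupleBoundary V 1 ∘ₗ tupleHtpy b 1 + tupleHtpy b 0 ∘ₗ tupleBoundary V 0 =
      LinearMap.id - tupleSd b 1 from LinearMap.congr_fun h c
    refine Finsupp.lhom_ext' fun v => LinearMap.ext_ring ?_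
    simp only [LinearMap.comp_apply, Finsupp.lsingle_apply, LinearMap.add_apply,
      LinearMap.sub_apply, LinearMap.id_apply, tupleHtpy_succ_single, tupleSd_succ_single,
      tupleBoundary_tupleCone]
    simp [tupleHtpy, tupleSd]
  | succ n ih =>
    intro c
    suffices h : tupleBoundary V (n + 2) ∘ₗ tupleHtpy b (n + 2) +
      tupleHtpy b (n + 1) ∘ₗ tupleBoundary V (n + 1) =
      LinearMap.id - tupleSd b (n + 2) from LinearMap.congr_fun h c
    refine Finsupp.lhom_ext' fun v => LinearMap.ext_ring ?_
    simp only [LinearMap.comp_apply, Finsupp.lsingle_apply, LinearMap.add_apply,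
      LinearMap.sub_apply, LinearMap.id_apply, tupleHtpy_succ_single b v, tupleSd_succ_single b v,
      tupleBoundary_tupleCone]
    have h := ih (tupleBoundary V (n + 1) (Finsupp.single v 1))
    rw [tupleBoundary_tupleBoundary, map_zero, add_zero] at h
    rw [map_sub (tupleBoundary V (n + 1)), h, sub_sub_cancel]
    abel

lemma tupleBoundary_mapDomain (f : V → V') (c : TupleChain V (n + 1)) :
    tupleBoundary V' n (Finsupp.lmapDomain ℚ ℚ (fun v => f ∘ v) c) =
      Finsupp.lmapDomain ℚ ℚ (fun v => f ∘ v) (tupleBoundary V n c) := by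
  suffices h : tupleBoundary V' n ∘ₗ Finsupp.lmapDomain ℚ ℚ (fun v => f ∘ v) =
      Finsupp.lmapDomain ℚ ℚ (fun v => f ∘ v) ∘ₗ tupleBoundary V n from LinearMap.congr_fun h c
  refine Finsupp.lhom_ext' fun v => LinearMap.ext_ring ?_
  simp [tupleBoundary_single, Finsupp.mapDomain_single, Function.comp_assoc]

lemma tupleCone_mapDomain (f : V → V') (b : V) (c : TupleChain V n) :
    tupleCone n (f b) (Finsupp.lmapDomain ℚ ℚ (fun v => f ∘ v) c) =
      Finsupp.lmapDomain ℚ ℚ (fun v => f ∘ v) (tupleCone n b c) := by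
  suffices h : tupleCone n (f b) ∘ₗ Finsupp.lmapDomain ℚ ℚ (fun v => f ∘ v) =
      Finsupp.lmapDomain ℚ ℚ (fun v => f ∘ v) ∘ₗ tupleCone n b from LinearMap.congr_fun h c
  refine Finsupp.lhom_ext' fun v => LinearMap.ext_ring ?_
  simp [tupleCone_single, Finsupp.mapDomain_single, Fin.comp_cons]

variable {b : ∀ n, (Fin (n + 1) → V) → V} {b' : ∀ n, (Fin (n + 1) → V') → V'} {f : V → V'}

lemma tupleSd_mapDomain (hf : ∀ n v, f (b n v) = b' n (f ∘ v)) : ∀ (n : ℕ) (c : TupleChain V n),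
    tupleSd b' n (Finsupp.lmapDomain ℚ ℚ (fun v => f ∘ v) c) =
      Finsupp.lmapDomain ℚ ℚ (fun v => f ∘ v) (tupleSd b n c) := by
  intro n
  induction n with
  | zero => intro c; rfl
  | succ n ih =>
    intro c
    suffices h : tupleSd b' (n + 1) ∘ₗ Finsupp.lmapDomain ℚ ℚ (fun v => f ∘ v) =
      Finsupp.lmapDomain ℚ ℚ (fun v => f ∘ v) ∘ₗ tupleSd b (n + 1) from LinearMap.congr_fun h c
    refine Finsupp.lhom_ext' fun v => LinearMap.ext_ring ?_
    have h1 : Finsupp.lmapDomain ℚ ℚ (fun v : Fin (n + 1) → V => f ∘ v) (Finsupp.single v 1) =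
      Finsupp.single (f ∘ v) 1 := by simp
    simp only [LinearMap.comp_apply, Finsupp.lsingle_apply, tupleSd_succ_single]
    rw [← tupleCone_mapDomain, ← ih, ← tupleBoundary_mapDomain, h1, tupleSd_succ_single, hf]

lemma tupleHtpy_mapDomain (hf : ∀ n v, f (b n v) = b' n (f ∘ v)) : ∀ (n : ℕ) (c : TupleChain V n),
    tupleHtpy b' n (Finsupp.lmapDomain ℚ ℚ (fun v => f ∘ v) c) =
      Finsupp.lmapDomain ℚ ℚ (fun v => f ∘ v) (tupleHtpy b n c) := by
  intro n
  induction n with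
  | zero => intro c; simp [tupleHtpy]
  | succ n ih =>
    intro c
    suffices h : tupleHtpy b' (n + 1) ∘ₗ Finsupp.lmapDomain ℚ ℚ (fun v => f ∘ v) =
      Finsupp.lmapDomain ℚ ℚ (fun v => f ∘ v) ∘ₗ tupleHtpy b (n + 1) from LinearMap.congr_fun h c
    refine Finsupp.lhom_ext' fun v => LinearMap.ext_ring ?_
    have h1 : Finsupp.lmapDomain ℚ ℚ (fun v : Fin (n + 1) → V => f ∘ v) (Finsupp.single v 1) =
      Finsupp.single (f ∘ v) 1 := by simp
    simp only [LinearMap.comp_apply, Finsupp.lsingle_apply, tupleHtpy_succ_single]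
    rw [← tupleCone_mapDomain, map_sub, ← ih, ← tupleBoundary_mapDomain, h1, tupleHtpy_succ_single,
      hf]

end Tuple

/-! ### Singular chains in an ambient space -/

/-- The standard simplex with `n` vertices. -/
abbrev Simp (n : ℕ) : Type := stdSimplex ℝ (Fin n)

/-- The affine map between standard simplices with prescribed values at the vertices. -/
def affineSimp {m n : ℕ} (v : Fin m → Simp n) : C(Simp m, Simp n) where
  toFun t := ⟨fun j => ∑ i, t.1 i * (v i).1 j, fun j => Finset.sum_nonneg fun i _ =>
      mul_nonneg (t.2.1 i) ((v i).2.1 j), by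
    rw [Finset.sum_comm]
    simp only [← Finset.mul_sum, (v _).2.2, mul_one, t.2.2]⟩
  continuous_toFun := by
    refine Continuous.subtype_mk (continuous_pi fun j => continuous_finsetSum _ fun i _ => ?_) _
    exact ((continuous_apply i).comp continuous_subtype_val).mul continuous_const

section Affine

variable {l m n : ℕ}

/-- The tuple of vertices of the standard simplex. -/
def vertices (n : ℕ) : Fin n → Simp n := fun i => stdSimplex.vertex i

lemma affineSimp_val (v : Fin m → Simp n) (t : Simp m) :
    (affineSimp v t).1 = ∑ i, t.1 i • (v i).1 := by
  funext j; simp [affineSimp]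

lemma affineSimp_vertices_apply (v : Fin m → Simp n) (i : Fin m) :
    affineSimp v (vertices m i) = v i := by
  refine Subtype.ext ?_
  rw [affineSimp_val]
  simp [vertices, Pi.single_apply]

lemma affineSimp_comp_vertices (v : Fin m → Simp n) : affineSimp v ∘ vertices m = v :=
  funext (affineSimp_vertices_apply v)

lemma affineSimp_comp_affineSimp (v : Fin m → Simp n) (w : Fin l → Simp m) :
    (affineSimp v).comp (affineSimp w) = affineSimp (affineSimp v ∘ w) := by
  refine ContinuousMap.ext fun t => Subtype.ext (funext fun j => ?_)
  simp only [affineSimp, ContinuousMap.comp_apply, ContinuousMap.coe_mk, Finset.sum_mul,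
    Finset.mul_sum, Function.comp_apply]
  rw [Finset.sum_comm]
  simp only [mul_assoc]

lemma affineSimp_vertices : affineSimp (vertices n) = ContinuousMap.id (Simp n) := by
  refine ContinuousMap.ext fun t => Subtype.ext (funext fun j => ?_)
  simp [affineSimp, vertices, Pi.single_apply]

/-- The barycenter of a nonempty tuple of points of a simplex. -/
def bary (m n : ℕ) (v : Fin (n + 1) → Simp m) : Simp m :=
  affineSimp v (stdSimplex.barycenter : stdSimplex ℝ (Fin (n + 1)))

lemma affineSimp_bary (v : Fin l → Simp m) (n : ℕ) (w : Fin (n + 1) → Simp l) :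
    affineSimp v (bary l n w) = bary m n (affineSimp v ∘ w) := by
  rw [bary, bary, ← affineSimp_comp_affineSimp]; rfl

end Affine

/-- Rational singular chains; degree `n` means `n` vertices, so that degree `0` is the
augmentation term. -/
abbrev SingChain (E : Type*) [TopologicalSpace E] (n : ℕ) : Type _ := C(Simp n, E) →₀ ℚ

section Sing

variable {E : Type*} [TopologicalSpace E] {m n : ℕ}

/-- The image of a tuple chain in a simplex under a singular simplex. -/
def push (σ : C(Simp n, E)) (m : ℕ) : TupleChain (Simp n) m →ₗ[ℚ] SingChain E m :=
  Finsupp.lmapDomain ℚ ℚ fun v => σ.comp (affineSimp v)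

/-- The `i`-th face of a singular simplex. -/
def face (σ : C(Simp (n + 1), E)) (i : Fin (n + 1)) : C(Simp n, E) :=
  σ.comp (affineSimp (vertices (n + 1) ∘ i.succAbove))

variable (E) in
/-- The (augmented) singular boundary. -/
def singBoundary (n : ℕ) : SingChain E (n + 1) →ₗ[ℚ] SingChain E n :=
  Finsupp.linearCombination ℚ fun σ : C(Simp (n + 1), E) =>
    ∑ i : Fin (n + 1), Finsupp.single (face σ i) ((-1 : ℚ) ^ (i : ℕ))

variable (E) in
/-- Barycentric subdivision of singular chains. -/
def singSd (n : ℕ) : SingChain E n →ₗ[ℚ] SingChain E n :=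
  Finsupp.linearCombination ℚ fun σ : C(Simp n, E) =>
    push σ n (tupleSd (bary n) n (Finsupp.single (vertices n) 1))

variable (E) in
/-- The chain homotopy between the identity and barycentric subdivision. -/
def singHtpy (n : ℕ) : SingChain E n →ₗ[ℚ] SingChain E (n + 1) :=
  Finsupp.linearCombination ℚ fun σ : C(Simp n, E) =>
    push σ (n + 1) (tupleHtpy (bary n) n (Finsupp.single (vertices n) 1))

lemma push_single (σ : C(Simp n, E)) (v : Fin m → Simp n) (q : ℚ) :
    push σ m (Finsupp.single v q) = Finsupp.single (σ.comp (affineSimp v)) q := by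
  simp [push]

lemma push_vertices (σ : C(Simp n, E)) :
    push σ n (Finsupp.single (vertices n) 1) = Finsupp.single σ 1 := by
  rw [push_single, affineSimp_vertices, ContinuousMap.comp_id]

lemma push_comp_affineSimp (σ : C(Simp n, E)) {l : ℕ} (v : Fin m → Simp n)
    (c : TupleChain (Simp m) l) : push (σ.comp (affineSimp v)) l c =
      push σ l (Finsupp.lmapDomain ℚ ℚ (fun w => affineSimp v ∘ w) c) := by
  suffices h : push (σ.comp (affineSimp v)) l =
      push σ l ∘ₗ Finsupp.lmapDomain ℚ ℚ (fun w => affineSimp v ∘ w) from LinearMap.congr_fun h c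
  refine Finsupp.lhom_ext' fun w => LinearMap.ext_ring ?_
  simp [push, ContinuousMap.comp_assoc, affineSimp_comp_affineSimp]

lemma singBoundary_single (σ : C(Simp (n + 1), E)) :
    singBoundary E n (Finsupp.single σ 1) =
      ∑ i : Fin (n + 1), Finsupp.single (face σ i) ((-1 : ℚ) ^ (i : ℕ)) := by
  simp [singBoundary]

lemma singBoundary_push (σ : C(Simp n, E)) (c : TupleChain (Simp n) (m + 1)) :
    singBoundary E m (push σ (m + 1) c) = push σ m (tupleBoundary _ m c) := by
  suffices h : singBoundary E m ∘ₗ push σ (m + 1) = push σ m ∘ₗ tupleBoundary _ m from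
    LinearMap.congr_fun h c
  refine Finsupp.lhom_ext' fun v => LinearMap.ext_ring ?_
  simp only [LinearMap.comp_apply, Finsupp.lsingle_apply, push_single, singBoundary_single,
    tupleBoundary_single, map_sum, face, ContinuousMap.comp_assoc, affineSimp_comp_affineSimp,
    ← Function.comp_assoc, affineSimp_comp_vertices]

lemma lmapDomain_affineSimp_vertices (v : Fin m → Simp n) :
    Finsupp.lmapDomain ℚ ℚ (fun w => affineSimp v ∘ w) (Finsupp.single (vertices m) 1) =
      Finsupp.single v 1 := by
  simp [affineSimp_comp_vertices]

lemma singSd_push (σ : C(Simp n, E)) (c : TupleChain (Simp n) m) :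
    singSd E m (push σ m c) = push σ m (tupleSd (bary n) m c) := by
  suffices h : singSd E m ∘ₗ push σ m = push σ m ∘ₗ tupleSd (bary n) m from
    LinearMap.congr_fun h c
  refine Finsupp.lhom_ext' fun v => LinearMap.ext_ring ?_
  simp only [LinearMap.comp_apply, Finsupp.lsingle_apply, push_single]
  rw [singSd, Finsupp.linearCombination_single, one_smul, push_comp_affineSimp,
    ← tupleSd_mapDomain (affineSimp_bary v), lmapDomain_affineSimp_vertices]

lemma singHtpy_push (σ : C(Simp n, E)) (c : TupleChain (Simp n) m) :
    singHtpy E m (push σ m c) = push σ (m + 1) (tupleHtpy (bary n) m c) := by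
  suffices h : singHtpy E m ∘ₗ push σ m = push σ (m + 1) ∘ₗ tupleHtpy (bary n) m from
    LinearMap.congr_fun h c
  refine Finsupp.lhom_ext' fun v => LinearMap.ext_ring ?_
  simp only [LinearMap.comp_apply, Finsupp.lsingle_apply, push_single]
  rw [singHtpy, Finsupp.linearCombination_single, one_smul, push_comp_affineSimp,
    ← tupleHtpy_mapDomain (affineSimp_bary v), lmapDomain_affineSimp_vertices]

lemma singBoundary_singBoundary (c : SingChain E (n + 2)) :
    singBoundary E n (singBoundary E (n + 1) c) = 0 := by
  suffices h : singBoundary E n ∘ₗ singBoundary E (n + 1) = 0 from LinearMap.congr_fun h c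
  refine Finsupp.lhom_ext' fun σ => LinearMap.ext_ring ?_
  simp only [LinearMap.comp_apply, Finsupp.lsingle_apply, LinearMap.zero_apply]
  rw [← push_vertices, singBoundary_push, singBoundary_push, tupleBoundary_tupleBoundary, map_zero]

lemma singBoundary_singHtpy (c : SingChain E (n + 1)) :
    singBoundary E (n + 1) (singHtpy E (n + 1) c) + singHtpy E n (singBoundary E n c) =
      c - singSd E (n + 1) c := by
  suffices h : singBoundary E (n + 1) ∘ₗ singHtpy E (n + 1) + singHtpy E n ∘ₗ singBoundary E n =
      LinearMap.id - singSd E (n + 1) from LinearMap.congr_fun h c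
  refine Finsupp.lhom_ext' fun σ => LinearMap.ext_ring ?_
  simp only [LinearMap.comp_apply, Finsupp.lsingle_apply, LinearMap.add_apply,
      LinearMap.sub_apply, LinearMap.id_apply]
  rw [← push_vertices, singBoundary_push, singHtpy_push, singHtpy_push, singBoundary_push,
    singSd_push, ← map_add, tupleBoundary_tupleHtpy, map_sub]

/-- The singular chains of a subset of the ambient space. -/
def chainsIn (n : ℕ) (U : Set E) : Submodule ℚ (SingChain E n) :=
  Finsupp.supported ℚ ℚ {σ : C(Simp n, E) | ∀ t, σ t ∈ U}

lemma single_mem_chainsIn {U : Set E} {σ : C(Simp n, E)} (h : ∀ t, σ t ∈ U) (q : ℚ) :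
    Finsupp.single σ q ∈ chainsIn n U :=
  Finsupp.single_mem_supported ℚ q h

lemma chainsIn_le_iff {U : Set E} {P : Submodule ℚ (SingChain E n)} :
    chainsIn n U ≤ P ↔ ∀ σ : C(Simp n, E), (∀ t, σ t ∈ U) → Finsupp.single σ 1 ∈ P := by
  rw [chainsIn, Finsupp.supported_eq_span_single, Submodule.span_le, Set.image_subset_iff]
  rfl

lemma chainsIn_mono {U V : Set E} (h : U ⊆ V) : chainsIn n U ≤ chainsIn n V :=
  Finsupp.supported_mono fun _ hσ t => h (hσ t)

lemma chainsIn_inf (U V : Set E) : chainsIn n U ⊓ chainsIn n V = chainsIn n (U ∩ V) := by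
  rw [chainsIn, chainsIn, chainsIn, ← Finsupp.supported_inter]
  congr 1
  ext σ
  simp [forall_and]

lemma push_mem_chainsIn {U : Set E} {σ : C(Simp n, E)} (h : ∀ t, σ t ∈ U)
    (c : TupleChain (Simp n) m) : push σ m c ∈ chainsIn m U := by
  induction c using Finsupp.induction_linear with
  | zero => simp
  | add c c' hc hc' => rw [map_add]; exact add_mem hc hc'
  | single v q =>
    rw [push_single]
    exact single_mem_chainsIn (σ := σ.comp (affineSimp v)) (fun t => h _) q

lemma singBoundary_mem_chainsIn {U : Set E} {c : SingChain E (n + 1)}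
    (hc : c ∈ chainsIn (n + 1) U) :
    singBoundary E n c ∈ chainsIn n U := by
  suffices h : chainsIn (n + 1) U ≤ (chainsIn n U).comap (singBoundary E n) from h hc
  refine chainsIn_le_iff.2 fun σ hσ => ?_
  rw [Submodule.mem_comap, ← push_vertices, singBoundary_push]
  exact push_mem_chainsIn hσ _

lemma singHtpy_mem_chainsIn {U : Set E} {c : SingChain E n} (hc : c ∈ chainsIn n U) :
    singHtpy E n c ∈ chainsIn (n + 1) U := by
  suffices h : chainsIn n U ≤ (chainsIn (n + 1) U).comap (singHtpy E n) from h hc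
  refine chainsIn_le_iff.2 fun σ hσ => ?_
  rw [Submodule.mem_comap, ← push_vertices, singHtpy_push]
  exact push_mem_chainsIn hσ _

end Sing

/-! ### Small simplices -/

section Small

variable {m n : ℕ}

/-- Tuple chains in a simplex all of whose tuples have vertices in `K` at mutual distance at
most `δ`. -/
def smallTuples (K : Set (Fin m → ℝ)) (δ : ℝ) (n : ℕ) : Submodule ℚ (TupleChain (Simp m) n) :=
  Finsupp.supported ℚ ℚ {v | (∀ i, (v i).1 ∈ K) ∧ ∀ i j, dist (v i) (v j) ≤ δ}

lemma smallTuples_le_iff {K : Set (Fin m → ℝ)} {δ : ℝ} {P : Submodule ℚ (TupleChain (Simp m) n)} :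
    smallTuples K δ n ≤ P ↔ ∀ v : Fin n → Simp m, (∀ i, (v i).1 ∈ K) →
      (∀ i j, dist (v i) (v j) ≤ δ) → Finsupp.single v 1 ∈ P := by
  rw [smallTuples, Finsupp.supported_eq_span_single, Submodule.span_le, Set.image_subset_iff]
  exact ⟨fun h v h1 h2 => h ⟨h1, h2⟩, fun h v hv => h v hv.1 hv.2⟩

lemma single_mem_smallTuples {K : Set (Fin m → ℝ)} {δ : ℝ} {v : Fin n → Simp m}
    (h1 : ∀ i, (v i).1 ∈ K) (h2 : ∀ i j, dist (v i) (v j) ≤ δ) (q : ℚ) :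
    Finsupp.single v q ∈ smallTuples K δ n :=
  Finsupp.single_mem_supported ℚ q ⟨h1, h2⟩

lemma affineSimp_mem {K : Set (Fin m → ℝ)} (hK : Convex ℝ K) {v : Fin n → Simp m}
    (hv : ∀ i, (v i).1 ∈ K) (t : Simp n) : (affineSimp v t).1 ∈ K := by
  rw [affineSimp_val]
  exact hK.sum_mem (fun i _ => t.2.1 i) t.2.2 fun i _ => hv i

lemma dist_bary_le {δ : ℝ} {v : Fin (n + 1) → Simp m} (hv : ∀ i j, dist (v i) (v j) ≤ δ)
    (j : Fin (n + 1)) : dist (v j) (bary m n v) ≤ (1 - 1 / (n + 1 : ℝ)) * δ := by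
  have hn : (0 : ℝ) < n + 1 := by positivity
  rw [Subtype.dist_eq, dist_comm, dist_eq_norm]
  have h : (bary m n v).1 - (v j).1 = ∑ i, (1 / (n + 1 : ℝ)) • ((v i).1 - (v j).1) := by
    rw [bary, affineSimp_val]
    simp only [smul_sub, Finset.sum_sub_distrib, Finset.sum_const, Finset.card_univ,
      Fintype.card_fin, stdSimplex.barycenter_apply]
    rw [← Nat.cast_smul_eq_nsmul ℝ, smul_smul]
    push_cast
    rw [mul_one_div_cancel hn.ne']
    simp
  rw [h, ← Finset.sum_erase (a := j) _ (by simp)]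
  refine (norm_sum_le_of_le (f := fun i => (1 / (n + 1 : ℝ)) • ((v i).1 - (v j).1))
    (n := fun _ => 1 / (n + 1 : ℝ) * δ) _ fun i _ => ?_).trans ?_
  · rw [norm_smul, ← dist_eq_norm, Real.norm_of_nonneg (by positivity)]
    exact mul_le_mul_of_nonneg_left (hv i j) (by positivity)
  · simp only [Finset.sum_const, Finset.card_erase_of_mem (Finset.mem_univ j), Finset.card_univ,
      Fintype.card_fin, nsmul_eq_mul, Nat.add_sub_cancel]
    apply le_of_eq
    field_simp
    ring

lemma tupleSd_mem_smallTuples {N : ℕ} {δ : ℝ} (hδ : 0 ≤ δ) : ∀ (n : ℕ), n ≤ N →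
    ∀ (K : Set (Fin m → ℝ)), Convex ℝ K → ∀ c ∈ smallTuples K δ n,
      tupleSd (bary m) n c ∈ smallTuples K ((1 - 1 / (N : ℝ)) * δ) n := by
  intro n
  induction n with
  | zero =>
    intro _ K _ c hc
    suffices h : smallTuples K δ 0 ≤ (smallTuples K ((1 - 1 / (N : ℝ)) * δ) 0).comap
      (tupleSd (bary m) 0) from h hc
    refine smallTuples_le_iff.2 fun v _ _ => ?_
    exact single_mem_smallTuples (fun i => i.elim0) (fun i => i.elim0) 1
  | succ n ih =>
    intro hN K hK c hc
    suffices h : smallTuples K δ (n + 1) ≤ (smallTuples K ((1 - 1 / (N : ℝ)) * δ) (n + 1)).comap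
      (tupleSd (bary m) (n + 1)) from h hc
    refine smallTuples_le_iff.2 fun v hvK hv => ?_
    rw [Submodule.mem_comap, tupleSd_succ_single]
    set r : ℝ := (1 - 1 / (N : ℝ)) * δ with hr
    have hb : ∀ j, dist (v j) (bary m n v) ≤ r := fun j => (dist_bary_le hv j).trans <| by
      have h1 : ((n + 1 : ℕ) : ℝ) ≤ N := by exact_mod_cast hN
      push_cast at h1
      have h2 : (0 : ℝ) < n + 1 := by positivity
      exact mul_le_mul_of_nonneg_right (sub_le_sub_left (one_div_le_one_div_of_le h2 h1) 1) hδ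
    have hr0 : 0 ≤ r := dist_nonneg.trans (hb 0)
    set K' := K ∩ Metric.closedBall (bary m n v).1 r
    have hK' : Convex ℝ K' := hK.inter (convex_closedBall _ _)
    have hbd : tupleBoundary _ n (Finsupp.single v 1) ∈ smallTuples K' δ n := by
      rw [tupleBoundary_single]
      exact Submodule.sum_mem _ fun i _ => single_mem_smallTuples
        (fun j => Set.mem_inter (hvK _) (hb _)) (fun _ _ => hv _ _) _
    have h := ih (Nat.le_of_succ_le hN) K' hK' _ hbd
    suffices h' : smallTuples K' r n ≤ (smallTuples K r (n + 1)).comap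
      (tupleCone n (bary m n v)) from h' h
    refine smallTuples_le_iff.2 fun w hwK hw => ?_
    rw [Submodule.mem_comap, tupleCone_single]
    refine single_mem_smallTuples (fun i => ?_) (fun i j => ?_) 1
    · refine Fin.cases ?_ (fun i => ?_) i
      · exact affineSimp_mem hK hvK _
      · exact (hwK i).1
    · refine Fin.cases ?_ (fun i => ?_) i <;> refine Fin.cases ?_ (fun j => ?_) j
      · simpa using hr0
      · rw [dist_comm]
        exact (hwK j).2
      · exact (hwK i).2
      · simpa using hw i j

lemma iterate_tupleSd_mem_smallTuples {δ : ℝ} (hδ : 0 ≤ δ) (hn : 1 ≤ n)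
    {c : TupleChain (Simp m) n} (hc : c ∈ smallTuples Set.univ δ n) (j : ℕ) :
    (tupleSd (bary m) n)^[j] c ∈ smallTuples Set.univ ((1 - 1 / (n : ℝ)) ^ j * δ) n := by
  have hn' : (1 : ℝ) ≤ n := by exact_mod_cast hn
  have h0 : (0 : ℝ) ≤ 1 - 1 / (n : ℝ) := by
    rw [sub_nonneg, div_le_one (by linarith)]; exact hn'
  induction j with
  | zero => simpa using hc
  | succ j ih =>
    rw [Function.iterate_succ_apply', pow_succ', mul_assoc]
    exact tupleSd_mem_smallTuples (by positivity) n le_rfl _ convex_univ _ ih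

variable {E : Type*} [TopologicalSpace E] {A B : Set E}

lemma iterate_singSd_push (σ : C(Simp m, E)) (c : TupleChain (Simp m) n) (j : ℕ) :
    (singSd E n)^[j] (push σ n c) = push σ n ((tupleSd (bary m) n)^[j] c) := by
  induction j with
  | zero => rfl
  | succ j ih => rw [Function.iterate_succ_apply', ih, singSd_push, Function.iterate_succ_apply']

lemma eventually_iterate_singSd_single (hA : IsOpen A) (hB : IsOpen B) (σ : C(Simp n, E))
    (hσ : ∀ t, σ t ∈ A ∪ B) : ∀ᶠ j in atTop,
      (singSd E n)^[j] (Finsupp.single σ 1) ∈ chainsIn n A ⊔ chainsIn n B := by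
  obtain rfl | hn := Nat.eq_zero_or_pos n
  · refine Eventually.of_forall fun j => ?_
    have hc : ∀ c : SingChain E 0, c ∈ chainsIn 0 A := fun c σ _ t => by
      simpa using t.2.2
    exact Submodule.mem_sup_left (hc _)
  obtain ⟨δ, hδ, hleb⟩ := lebesgue_number_lemma_of_metric (s := (Set.univ : Set (Simp n)))
    (c := fun b : Bool => σ ⁻¹' (cond b A B)) isCompact_univ
    (fun b => by cases b; exacts [hB.preimage σ.continuous, hA.preimage σ.continuous])
    (fun t _ => by
      rcases hσ t with h | h
      · exact Set.mem_iUnion.2 ⟨true, h⟩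
      · exact Set.mem_iUnion.2 ⟨false, h⟩)
  have hn' : (1 : ℝ) ≤ n := by exact_mod_cast hn
  have h0 : (0 : ℝ) ≤ 1 - 1 / (n : ℝ) := by
    rw [sub_nonneg, div_le_one (by linarith)]; exact hn'
  have h1 : 1 - 1 / (n : ℝ) < 1 := by
    have : 0 < 1 / (n : ℝ) := by positivity
    linarith
  set D := Metric.diam (Set.univ : Set (Simp n))
  have hι : Finsupp.single (vertices n) 1 ∈ smallTuples Set.univ D n :=
    single_mem_smallTuples (fun _ => Set.mem_univ _) (fun i j =>
      Metric.dist_le_diam_of_mem isCompact_univ.isBounded (Set.mem_univ _)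
        (Set.mem_univ _)) 1
  have hlim : Tendsto (fun j : ℕ => (1 - 1 / (n : ℝ)) ^ j * D) atTop (𝓝 0) := by
    simpa using (tendsto_pow_atTop_nhds_zero_of_lt_one h0 h1).mul_const D
  filter_upwards [hlim.eventually_lt_const hδ] with j hj
  rw [← push_vertices, iterate_singSd_push]
  refine (?_ : smallTuples Set.univ _ n ≤ (chainsIn n A ⊔ chainsIn n B).comap (push σ n))
    (iterate_tupleSd_mem_smallTuples Metric.diam_nonneg hn hι j)
  refine smallTuples_le_iff.2 fun w _ hw => ?_
  rw [Submodule.mem_comap, push_single]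
  obtain ⟨b, hb⟩ := hleb (w ⟨0, hn⟩) trivial
  have hmem : ∀ t, affineSimp w t ∈ Metric.ball (w ⟨0, hn⟩) δ := fun t =>
    affineSimp_mem (convex_ball (w ⟨0, hn⟩).1 δ) (fun i => (hw i _).trans_lt hj) t
  cases b
  · exact Submodule.mem_sup_right
      (single_mem_chainsIn (σ := σ.comp (affineSimp w)) (fun t => hb (hmem t)) 1)
  · exact Submodule.mem_sup_left
      (single_mem_chainsIn (σ := σ.comp (affineSimp w)) (fun t => hb (hmem t)) 1)

lemma eventually_iterate_singSd (hA : IsOpen A) (hB : IsOpen B) {c : SingChain E n}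
    (hc : c ∈ chainsIn n (A ∪ B)) : ∀ᶠ j in atTop,
      (singSd E n)^[j] c ∈ chainsIn n A ⊔ chainsIn n B := by
  let P : Submodule ℚ (SingChain E n) :=
    { carrier := {c | ∀ᶠ j in atTop, (singSd E n)^[j] c ∈ chainsIn n A ⊔ chainsIn n B}
      add_mem' := fun {x y} hx hy => by
        filter_upwards [hx, hy] with j h1 h2
        rw [iterate_map_add]
        exact add_mem h1 h2
      zero_mem' := by simp [iterate_map_zero]
      smul_mem' := fun q x hx => by
        filter_upwards [hx] with j h
        rw [← Module.End.pow_apply, map_smul, Module.End.pow_apply]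
        exact Submodule.smul_mem _ q h }
  suffices h : chainsIn n (A ∪ B) ≤ P from h hc
  exact chainsIn_le_iff.2 fun σ hσ => eventually_iterate_singSd_single hA hB σ hσ

/-- The cycles of `U`; in degree zero every augmentation chain is a cycle. -/
def cycles (n : ℕ) (U : Set E) : Submodule ℚ (SingChain E n) :=
  match n with
  | 0 => ⊤
  | n + 1 => chainsIn (n + 1) U ⊓ LinearMap.ker (singBoundary E n)

/-- The boundaries of `U`. -/
def boundaries (n : ℕ) (U : Set E) : Submodule ℚ (SingChain E n) :=
  (chainsIn (n + 1) U).map (singBoundary E n)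

lemma mem_cycles_succ {U : Set E} {c : SingChain E (n + 1)} :
    c ∈ cycles (n + 1) U ↔ c ∈ chainsIn (n + 1) U ∧ singBoundary E n c = 0 := Iff.rfl

lemma cycles_le_chainsIn : ∀ (n : ℕ) (U : Set E), cycles n U ≤ chainsIn n U
  | 0, _ => fun c _ _ _ t => by simpa using t.2.2
  | _ + 1, _ => inf_le_left

lemma boundaries_le_cycles : ∀ (n : ℕ) (U : Set E), boundaries n U ≤ cycles n U
  | 0, _ => le_top
  | n + 1, U => by
    rintro _ ⟨c, hc, rfl⟩
    exact ⟨singBoundary_mem_chainsIn hc, singBoundary_singBoundary c⟩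

lemma boundaries_mono {U V : Set E} (h : U ⊆ V) : boundaries n U ≤ boundaries n V :=
  Submodule.map_mono (chainsIn_mono h)

lemma cycles_mono {U V : Set E} (h : U ⊆ V) : ∀ n, cycles n U ≤ cycles n V
  | 0 => le_rfl
  | _ + 1 => inf_le_inf_right _ (chainsIn_mono h)

lemma sub_iterate_singSd_mem_boundaries {U : Set E} {c : SingChain E (n + 1)}
    (hc : c ∈ cycles (n + 1) U) (j : ℕ) : (singSd E (n + 1))^[j] c ∈ cycles (n + 1) U ∧
      c - (singSd E (n + 1))^[j] c ∈ boundaries (n + 1) U := by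
  induction j with
  | zero => simp [hc]
  | succ j ih =>
    rw [Function.iterate_succ_apply']
    set c' := (singSd E (n + 1))^[j] c
    have h : c' - singSd E (n + 1) c' ∈ boundaries (n + 1) U := by
      rw [← singBoundary_singHtpy, (mem_cycles_succ.1 ih.1).2, map_zero, add_zero]
      exact Submodule.mem_map_of_mem (singHtpy_mem_chainsIn (mem_cycles_succ.1 ih.1).1)
    refine ⟨?_, ?_⟩
    · simpa using sub_mem ih.1 (boundaries_le_cycles _ _ h)
    · simpa using add_mem ih.2 h

/-- Every cycle of a union of two open sets is homologous to a sum of chains of the two sets. -/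
lemma exists_small_cycle (hA : IsOpen A) (hB : IsOpen B) {c : SingChain E (n + 1)}
    (hc : c ∈ cycles (n + 1) (A ∪ B)) : ∃ a ∈ chainsIn (n + 1) A, ∃ b ∈ chainsIn (n + 1) B,
      c - (a + b) ∈ boundaries (n + 1) (A ∪ B) := by
  obtain ⟨j, hj⟩ := (eventually_iterate_singSd hA hB (cycles_le_chainsIn _ _ hc)).exists
  obtain ⟨a, ha, b, hb, hab⟩ := Submodule.mem_sup.1 hj
  exact ⟨a, ha, b, hb, hab ▸ (sub_iterate_singSd_mem_boundaries hc j).2⟩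

end Small

/-! ### Cones and acyclicity of convex sets -/

section Cone

variable {E : Type*} [NormedAddCommGroup E] {n : ℕ}

open Classical in
/-- The extension of a singular simplex by a constant. -/
def extendConst (b : E) (σ : C(Simp n, E)) (x : Fin n → ℝ) : E :=
  if h : x ∈ stdSimplex ℝ (Fin n) then σ ⟨x, h⟩ else b

lemma extendConst_coe (b : E) (σ : C(Simp n, E)) (t : Simp n) : extendConst b σ t.1 = σ t := by
  simp [extendConst]

lemma continuousOn_extendConst (b : E) (σ : C(Simp n, E)) :
    ContinuousOn (extendConst b σ) (stdSimplex ℝ (Fin n)) := by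
  rw [continuousOn_iff_continuous_domRestrict]
  convert σ.continuous using 1
  funext t
  exact extendConst_coe b σ t

lemma extendConst_mem {U : Set E} {b : E} {σ : C(Simp n, E)} (hb : b ∈ U) (hσ : ∀ t, σ t ∈ U)
    (x : Fin n → ℝ) : extendConst b σ x ∈ U := by
  unfold extendConst
  split_ifs
  exacts [hσ _, hb]

lemma exists_norm_extendConst_sub_le (b : E) (σ : C(Simp n, E)) :
    ∃ M, ∀ x, ‖extendConst b σ x - b‖ ≤ M := by
  obtain ⟨M, hM⟩ := (isCompact_range σ.continuous).isBounded.subset_closedBall b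
  refine ⟨max M 0, fun x => ?_⟩
  unfold extendConst
  split_ifs with h
  · rw [← dist_eq_norm]
    exact le_max_of_le_left (hM ⟨_, rfl⟩)
  · simp

variable [NormedSpace ℝ E]

/-- The point of the opposite face in barycentric coordinates from the zeroth vertex. -/
def coneTail (t : Fin (n + 1) → ℝ) : Fin n → ℝ := (1 - t 0)⁻¹ • fun i => t i.succ

lemma coneTail_mem {t : Fin (n + 1) → ℝ} (ht : t ∈ stdSimplex ℝ (Fin (n + 1))) (h : t 0 ≠ 1) :
    coneTail t ∈ stdSimplex ℝ (Fin n) := by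
  have h1 := ht.2
  rw [Fin.sum_univ_succ] at h1
  have h2 : 0 ≤ ∑ i : Fin n, t i.succ := Finset.sum_nonneg fun i _ => ht.1 _
  have h3 : 1 - t 0 ≠ 0 := sub_ne_zero.2 h.symm
  refine ⟨fun i => mul_nonneg (inv_nonneg.2 (by linarith)) (ht.1 _), ?_⟩
  simp only [coneTail, Pi.smul_apply, smul_eq_mul, ← Finset.mul_sum]
  rw [inv_mul_eq_one₀ h3]
  linarith

/-- The cone on a singular simplex. -/
def coneMap (b : E) (σ : C(Simp n, E)) : C(Simp (n + 1), E) where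
  toFun t := t.1 0 • b + (1 - t.1 0) • extendConst b σ (coneTail t.1)
  continuous_toFun := by
    have h0 : Continuous fun t : Simp (n + 1) => t.1 0 :=
      (continuous_apply 0).comp continuous_subtype_val
    refine continuous_iff_continuousAt.2 fun t => ?_
    by_cases ht : t.1 0 = 1
    · obtain ⟨M, hM⟩ := exists_norm_extendConst_sub_le b σ
      have hval : t.1 0 • b + (1 - t.1 0) • extendConst b σ (coneTail t.1) = b := by simp [ht]
      rw [ContinuousAt, hval, tendsto_iff_norm_sub_tendsto_zero]
      have hlim : Tendsto (fun s : Simp (n + 1) => |1 - s.1 0| * M) (𝓝 t) (𝓝 0) := by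
        have h := ((continuous_const.sub h0).abs.mul continuous_const).tendsto
          (f := fun s : Simp (n + 1) => |1 - s.1 0| * M) t
        simpa [ht] using h
      refine squeeze_zero (fun _ => norm_nonneg _) (fun s => ?_) hlim
      have h : s.1 0 • b + (1 - s.1 0) • extendConst b σ (coneTail s.1) - b =
          (1 - s.1 0) • (extendConst b σ (coneTail s.1) - b) := by module
      rw [h, norm_smul]
      exact mul_le_mul_of_nonneg_left (hM _) (norm_nonneg _)
    · have hopen : IsOpen {s : Simp (n + 1) | s.1 0 ≠ 1} := isOpen_ne_fun h0 continuous_const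
      refine ContinuousOn.continuousAt (s := {s : Simp (n + 1) | s.1 0 ≠ 1}) ?_
        (hopen.mem_nhds ht)
      have htail : ContinuousOn (fun s : Simp (n + 1) => coneTail s.1) {s | s.1 0 ≠ 1} := by
        refine ContinuousOn.smul (ContinuousOn.inv₀ (continuous_const.sub h0).continuousOn
          fun s hs => sub_ne_zero.2 (Ne.symm hs)) (Continuous.continuousOn ?_)
        exact continuous_pi fun i => (continuous_apply _).comp continuous_subtype_val
      exact (h0.continuousOn.smul continuousOn_const).add
        ((continuous_const.sub h0).continuousOn.smul
          ((continuousOn_extendConst b σ).comp htail fun s hs => coneTail_mem s.2 hs))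

lemma coneMap_mem {U : Set E} (hU : Convex ℝ U) {b : E} {σ : C(Simp n, E)} (hb : b ∈ U)
    (hσ : ∀ t, σ t ∈ U) (t : Simp (n + 1)) : coneMap b σ t ∈ U :=
  hU hb (extendConst_mem hb hσ _) (t.2.1 0) (sub_nonneg.2 (stdSimplex.le_one t 0)) (by ring)

lemma affineSimp_vertices_comp_val {m : ℕ} (f : Fin m → Fin n) (t : Simp m) (j : Fin n) :
    (affineSimp (vertices n ∘ f) t).1 j = ∑ i, if f i = j then t.1 i else 0 := by
  simp [affineSimp, vertices, Pi.single_apply, eq_comm]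

lemma face_coneMap_zero (b : E) (σ : C(Simp n, E)) : face (coneMap b σ) 0 = σ := by
  refine ContinuousMap.ext fun t => ?_
  have h0 : (affineSimp (vertices (n + 1) ∘ (0 : Fin (n + 1)).succAbove) t).1 0 = 0 := by
    rw [affineSimp_vertices_comp_val]
    simp
  have h1 : coneTail (affineSimp (vertices (n + 1) ∘ (0 : Fin (n + 1)).succAbove) t).1 = t.1 := by
    funext j
    simp only [coneTail, h0, Pi.smul_apply, affineSimp_vertices_comp_val]
    simp
  change (_ : ℝ) • b + (1 - (_ : ℝ)) • extendConst b σ (coneTail _) = _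
  rw [h0, h1, extendConst_coe]
  simp

lemma face_coneMap_succ (b : E) (σ : C(Simp (n + 1), E)) (i : Fin (n + 1)) :
    face (coneMap b σ) i.succ = coneMap b (face σ i) := by
  refine ContinuousMap.ext fun t => ?_
  have h0 : (affineSimp (vertices (n + 2) ∘ i.succ.succAbove) t).1 0 = t.1 0 := by
    rw [affineSimp_vertices_comp_val, Fin.sum_univ_succ]
    simp
  change (_ : ℝ) • b + (1 - (_ : ℝ)) • extendConst b σ (coneTail _) =
    (_ : ℝ) • b + (1 - (_ : ℝ)) • extendConst b (face σ i) (coneTail _)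
  rw [h0]
  by_cases ht : t.1 0 = 1
  · simp [ht]
  · have h1 : coneTail (affineSimp (vertices (n + 2) ∘ i.succ.succAbove) t).1 =
        (affineSimp (vertices (n + 1) ∘ i.succAbove) ⟨coneTail t.1, coneTail_mem t.2 ht⟩).1 := by
      funext j
      rw [affineSimp_vertices_comp_val]
      simp only [coneTail, h0, Pi.smul_apply, affineSimp_vertices_comp_val]
      rw [Fin.sum_univ_succ]
      rw [Fin.succ_succAbove_zero, if_neg (Fin.succ_ne_zero j).symm, zero_add, smul_eq_mul,
        Finset.mul_sum]
      simp
    rw [h1, extendConst_coe, extendConst, dif_pos (coneTail_mem t.2 ht)]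
    rfl

/-- The cone operator on singular chains. -/
def singCone (b : E) (n : ℕ) : SingChain E n →ₗ[ℚ] SingChain E (n + 1) :=
  Finsupp.lmapDomain ℚ ℚ (coneMap b)

lemma singCone_single (b : E) (σ : C(Simp n, E)) (q : ℚ) :
    singCone b n (Finsupp.single σ q) = Finsupp.single (coneMap b σ) q := by
  simp [singCone]

lemma singBoundary_singCone_zero (b : E) (c : SingChain E 0) :
    singBoundary E 0 (singCone b 0 c) = c := by
  suffices h : singBoundary E 0 ∘ₗ singCone b 0 = LinearMap.id from LinearMap.congr_fun h c
  refine Finsupp.lhom_ext' fun σ => LinearMap.ext_ring ?_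
  simp [singCone_single, singBoundary_single, face_coneMap_zero]

lemma singBoundary_singCone (b : E) (c : SingChain E (n + 1)) :
    singBoundary E (n + 1) (singCone b (n + 1) c) = c - singCone b n (singBoundary E n c) := by
  suffices h : singBoundary E (n + 1) ∘ₗ singCone b (n + 1) =
      LinearMap.id - singCone b n ∘ₗ singBoundary E n from LinearMap.congr_fun h c
  refine Finsupp.lhom_ext' fun σ => LinearMap.ext_ring ?_
  simp only [LinearMap.comp_apply, Finsupp.lsingle_apply, LinearMap.sub_apply, LinearMap.id_apply,
    singCone_single, singBoundary_single, map_sum]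
  rw [Fin.sum_univ_succ]
  simp only [face_coneMap_succ, face_coneMap_zero, Fin.val_succ, pow_succ,
    Fin.val_zero, pow_zero, mul_neg, mul_one, Finsupp.single_neg, Finset.sum_neg_distrib]
  exact (sub_eq_add_neg _ _).symm

lemma cycles_le_boundaries_of_convex {U : Set E} (hU : Convex ℝ U) (hne : U.Nonempty) (n : ℕ) :
    cycles n U ≤ boundaries n U := by
  obtain ⟨b, hb⟩ := hne
  intro c hc
  refine ⟨singCone b n c, ?_, ?_⟩
  · suffices h : chainsIn n U ≤ (chainsIn (n + 1) U).comap (singCone b n) from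
      h (cycles_le_chainsIn n U hc)
    refine chainsIn_le_iff.2 fun σ hσ => ?_
    rw [Submodule.mem_comap, singCone_single]
    exact single_mem_chainsIn (coneMap_mem hU hb hσ) 1
  · cases n with
    | zero => exact singBoundary_singCone_zero b c
    | succ n => rw [singBoundary_singCone, (mem_cycles_succ.1 hc).2, map_zero, sub_zero]

end Cone

/-! ### A Mayer-Vietoris bound -/

section MayerVietoris

variable {E : Type*} [TopologicalSpace E] {n : ℕ}

/-- The reduced homology of `U` with `n`-vertex simplices has dimension at most `m`. -/
def HomologyBound (n : ℕ) (U : Set E) (m : ℕ) : Prop :=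
  ∃ W : Submodule ℚ (SingChain E n), Module.Finite ℚ W ∧ Module.finrank ℚ W ≤ m ∧
    cycles n U ≤ W ⊔ boundaries n U

lemma HomologyBound.mono {U : Set E} {m m' : ℕ} (h : HomologyBound n U m) (hm : m ≤ m') :
    HomologyBound n U m' := by
  obtain ⟨W, h1, h2, h3⟩ := h
  exact ⟨W, h1, h2.trans hm, h3⟩

lemma homologyBound_of_cycles_le {U : Set E} (h : cycles n U ≤ boundaries n U) :
    HomologyBound n U 0 :=
  ⟨⊥, inferInstance, by simp, by simpa using h⟩

lemma exists_boundary_section (n : ℕ) (U : Set E) :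
    ∃ g : SingChain E n →ₗ[ℚ] SingChain E (n + 1), (∀ x, g x ∈ chainsIn (n + 1) U) ∧
      ∀ x ∈ boundaries n U, singBoundary E n (g x) = x := by
  let f := (singBoundary E n).domRestrict (chainsIn (n + 1) U)
  obtain ⟨g, hg⟩ := f.rangeRestrict.exists_rightInverse_of_surjective f.range_rangeRestrict
  obtain ⟨g', hg'⟩ := LinearMap.exists_extend g
  refine ⟨(chainsIn (n + 1) U).subtype ∘ₗ g', fun x => (g' x).2, ?_⟩
  rintro _ ⟨c, hc, rfl⟩
  have hx : singBoundary E n c ∈ LinearMap.range f := ⟨⟨c, hc⟩, rfl⟩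
  have h1 : g' (singBoundary E n c) = g ⟨_, hx⟩ := LinearMap.congr_fun hg' ⟨_, hx⟩
  have h2 := congrArg Subtype.val (LinearMap.congr_fun hg ⟨_, hx⟩)
  rw [LinearMap.comp_apply, h1]
  exact h2

lemma HomologyBound.union {A B : Set E} (hA : IsOpen A) (hB : IsOpen B) {a c : ℕ}
    (hbA : HomologyBound (n + 1) A a) (hbB : cycles (n + 1) B ≤ boundaries (n + 1) B)
    (hbAB : HomologyBound n (A ∩ B) c) : HomologyBound (n + 1) (A ∪ B) (a + c) := by
  obtain ⟨W, hW, hWa, hWc⟩ := hbA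
  obtain ⟨V, hV, hVc, hVb⟩ := hbAB
  obtain ⟨gA, hgA, hgA'⟩ := exists_boundary_section n A
  obtain ⟨gB, hgB, hgB'⟩ := exists_boundary_section n B
  refine ⟨W ⊔ V.map (gA - gB), inferInstance, ?_, fun z hz => ?_⟩
  · refine (Submodule.finrank_add_le_finrank_add_finrank _ _).trans (add_le_add hWa ?_)
    exact (Submodule.finrank_map_le _ _).trans hVc
  · obtain ⟨x, hx, y, hy, hxy⟩ := exists_small_cycle hA hB hz
    have hsum : singBoundary E n x + singBoundary E n y = 0 := by
      have h1 := (mem_cycles_succ.1 (boundaries_le_cycles _ _ hxy)).2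
      rw [map_sub, (mem_cycles_succ.1 hz).2, zero_sub, neg_eq_zero, map_add] at h1
      exact h1
    have hneg := eq_neg_of_add_eq_zero_left hsum
    have hcyc : singBoundary E n x ∈ cycles n (A ∩ B) := by
      have hmem : singBoundary E n x ∈ chainsIn n (A ∩ B) := by
        rw [← chainsIn_inf]
        refine ⟨singBoundary_mem_chainsIn hx, ?_⟩
        rw [hneg]
        exact neg_mem (singBoundary_mem_chainsIn hy)
      cases n with
      | zero => trivial
      | succ n => exact ⟨hmem, singBoundary_singBoundary x⟩
    obtain ⟨w, hw, _, ⟨u, hu, rfl⟩, hwu⟩ := Submodule.mem_sup.1 (hVb hcyc)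
    have huA : u ∈ chainsIn (n + 1) A := chainsIn_mono Set.inter_subset_left hu
    have huB : u ∈ chainsIn (n + 1) B := chainsIn_mono Set.inter_subset_right hu
    have hwA : w = singBoundary E n (x - u) := by rw [map_sub, ← hwu, add_sub_cancel_right]
    have hwB : w = singBoundary E n (-(y + u)) := by
      rw [map_neg, map_add, neg_add, ← hneg, ← hwu, add_neg_cancel_right]
    have h1 : x - u - gA w ∈ cycles (n + 1) A := by
      refine ⟨sub_mem (sub_mem hx huA) (hgA w), ?_⟩
      change singBoundary E n _ = 0
      rw [map_sub, hgA' w (hwA ▸ Submodule.mem_map_of_mem (sub_mem hx huA)), ← hwA, sub_self]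
    have h2 : y + u + gB w ∈ cycles (n + 1) B := by
      refine ⟨add_mem (add_mem hy huB) (hgB w), ?_⟩
      change singBoundary E n _ = 0
      rw [map_add, hgB' w (hwB ▸ Submodule.mem_map_of_mem (neg_mem (add_mem hy huB)))]
      rw [hwB, map_neg, add_neg_cancel]
    have hz' : z = (x - u - gA w) + ((gA - gB) w + ((y + u + gB w) + (z - (x + y)))) := by
      rw [LinearMap.sub_apply]
      abel
    rw [hz']
    refine add_mem ?_ (add_mem ?_ (add_mem ?_ ?_))
    · exact sup_le_sup le_sup_left (boundaries_mono Set.subset_union_left) (hWc h1)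
    · exact Submodule.mem_sup_left (Submodule.mem_sup_right (Submodule.mem_map_of_mem hw))
    · exact Submodule.mem_sup_right (boundaries_mono Set.subset_union_right (hbB h2))
    · exact Submodule.mem_sup_right hxy

lemma homologyBound_zero (U : Set E) : HomologyBound 0 U 1 := by
  have : Unique C(Simp 0, E) :=
    { default := ⟨fun t => (by simpa using t.2.2 : False).elim, by
        refine continuous_iff_continuousAt.2 fun t => (by simpa using t.2.2 : False).elim⟩
      uniq := fun σ => ContinuousMap.ext fun t => (by simpa using t.2.2 : False).elim }
  refine ⟨⊤, inferInstance, ?_, le_sup_of_le_left le_top⟩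
  simp

lemma chainsIn_succ_empty (n : ℕ) : chainsIn (n + 1) (∅ : Set E) = ⊥ := by
  refine le_bot_iff.1 (chainsIn_le_iff.2 fun σ h => (h (vertices _ 0)).elim)

lemma homologyBound_empty (n : ℕ) : HomologyBound (n + 1) (∅ : Set E) 0 :=
  homologyBound_of_cycles_le <| (cycles_le_chainsIn _ _).trans (by simp [chainsIn_succ_empty])

end MayerVietoris

/-! ### Unions of convex open sets -/

section Nerve

variable {E ι : Type*}

open Classical in
/-- The `n`-element subsets of `s` spanning a simplex in the nerve of `C`. -/
def nerveFaces (C : ι → Set E) (s : Finset ι) (n : ℕ) : Finset (Finset ι) :=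
  (s.powersetCard n).filter fun σ => (⋂ i ∈ σ, C i).Nonempty

lemma mem_nerveFaces {C : ι → Set E} {s : Finset ι} {n : ℕ} {σ : Finset ι} :
    σ ∈ nerveFaces C s n ↔ (σ ⊆ s ∧ σ.card = n) ∧ (⋂ i ∈ σ, C i).Nonempty := by
  simp only [nerveFaces, Finset.mem_filter, Finset.mem_powersetCard]

lemma card_nerveFaces_zero [Nonempty E] (C : ι → Set E) (s : Finset ι) :
    (nerveFaces C s 0).card = 1 := by
  rw [Finset.card_eq_one]
  refine ⟨∅, Finset.ext fun σ => ?_⟩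
  rw [mem_nerveFaces, Finset.mem_singleton, Finset.card_eq_zero]
  refine ⟨fun h => h.1.2, ?_⟩
  rintro rfl
  simp

lemma card_nerveFaces_le_insert [DecidableEq ι] (C : ι → Set E) (s : Finset ι) (a : ι) (n : ℕ) :
    (nerveFaces C s n).card ≤ (nerveFaces C (insert a s) n).card :=
  Finset.card_le_card fun σ h => by
    rw [mem_nerveFaces] at h ⊢
    exact ⟨⟨h.1.1.trans (Finset.subset_insert a s), h.1.2⟩, h.2⟩

lemma card_nerveFaces_add_le [DecidableEq ι] {C : ι → Set E} {s : Finset ι} {a : ι} (ha : a ∉ s)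
    (hne : (C a).Nonempty) (n : ℕ) :
    (nerveFaces C s (n + 1)).card + (nerveFaces (fun i => C i ∩ C a) s n).card ≤
      (nerveFaces C (insert a s) (n + 1)).card := by
  have hna : ∀ {m : ℕ} {D : ι → Set E} {σ}, σ ∈ nerveFaces D s m → a ∉ σ := fun h h' =>
    ha ((mem_nerveFaces.1 h).1.1 h')
  have hinj : Set.InjOn (insert a) (nerveFaces (fun i => C i ∩ C a) s n : Set (Finset ι)) := by
    intro σ hσ τ hτ h
    rw [← Finset.erase_insert (hna hσ), ← Finset.erase_insert (hna hτ), h]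
  rw [← Finset.card_image_of_injOn hinj, ← Finset.card_union_of_disjoint]
  · refine Finset.card_le_card (Finset.union_subset (fun σ hσ => ?_) fun σ hσ => ?_)
    · rw [mem_nerveFaces] at hσ ⊢
      exact ⟨⟨hσ.1.1.trans (Finset.subset_insert a s), hσ.1.2⟩, hσ.2⟩
    · obtain ⟨τ, hτ, rfl⟩ := Finset.mem_image.1 hσ
      have hτa := hna hτ
      rw [mem_nerveFaces] at hτ ⊢
      refine ⟨⟨Finset.insert_subset_insert a hτ.1.1, ?_⟩, ?_⟩
      · rw [Finset.card_insert_of_notMem hτa, hτ.1.2]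
      · rw [Finset.set_biInter_insert]
        obtain rfl | ⟨i, hi⟩ := τ.eq_empty_or_nonempty
        · simpa using hne
        · obtain ⟨x, hx⟩ := hτ.2
          simp only [Set.mem_iInter] at hx
          exact ⟨x, (hx i hi).2, Set.mem_iInter₂.2 fun j hj => (hx j hj).1⟩
  · rw [Finset.disjoint_left]
    intro σ hσ hσ'
    obtain ⟨τ, -, rfl⟩ := Finset.mem_image.1 hσ'
    exact hna hσ (Finset.mem_insert_self a τ)

variable [NormedAddCommGroup E] [NormedSpace ℝ E]

lemma homologyBound_nerveFaces (s : Finset ι) : ∀ (C : ι → Set E), (∀ i, IsOpen (C i)) →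
    (∀ i, Convex ℝ (C i)) → ∀ n, HomologyBound n (⋃ i ∈ s, C i) (nerveFaces C s n).card := by
  classical
  induction s using Finset.induction_on with
  | empty =>
    intro C _ _ n
    cases n with
    | zero => exact card_nerveFaces_zero C ∅ ▸ homologyBound_zero _
    | succ n => simpa using (homologyBound_empty (E := E) n).mono (Nat.zero_le _)
  | insert a s ha ih =>
    intro C hC hC' n
    cases n with
    | zero => exact card_nerveFaces_zero C _ ▸ homologyBound_zero _
    | succ n =>
      rw [Finset.set_biUnion_insert]
      obtain hem | hne := (C a).eq_empty_or_nonempty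
      · rw [hem, Set.empty_union]
        exact (ih C hC hC' _).mono (card_nerveFaces_le_insert C s a _)
      · rw [Set.union_comm]
        refine HomologyBound.mono (HomologyBound.union (isOpen_biUnion fun i _ => hC i) (hC a)
          (ih C hC hC' _) (cycles_le_boundaries_of_convex (hC' a) hne _) ?_)
          (card_nerveFaces_add_le ha hne n)
        rw [Set.iUnion₂_inter]
        exact ih _ (fun i => (hC i).inter (hC a)) (fun i => (hC' i).inter (hC' a)) n

lemma homologyBound_choose (s : Finset ι) : ∀ (C : ι → Set E), (∀ i, IsOpen (C i)) →
    (∀ i, Convex ℝ (C i)) → ∀ n, HomologyBound n (⋃ i ∈ s, C i) ((s.card - 1).choose n) := by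
  classical
  induction s using Finset.induction_on with
  | empty =>
    intro C _ _ n
    cases n with
    | zero => exact homologyBound_zero _
    | succ n => simpa using homologyBound_empty (E := E) n
  | insert a s ha ih =>
    intro C hC hC' n
    cases n with
    | zero => simpa using homologyBound_zero _
    | succ n =>
      rw [Finset.set_biUnion_insert, Finset.card_insert_of_notMem ha, Nat.add_sub_cancel]
      obtain hem | hne := (C a).eq_empty_or_nonempty
      · rw [hem, Set.empty_union]
        exact (ih C hC hC' _).mono (Nat.choose_le_choose _ (Nat.sub_le _ _))
      obtain rfl | hs := s.eq_empty_or_nonempty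
      · simpa using homologyBound_of_cycles_le (cycles_le_boundaries_of_convex (hC' a) hne (n + 1))
      · rw [Set.union_comm]
        refine HomologyBound.mono (HomologyBound.union (isOpen_biUnion fun i _ => hC i) (hC a)
          (ih C hC hC' _) (cycles_le_boundaries_of_convex (hC' a) hne _)
          (c := (s.card - 1).choose n) ?_) ?_
        · rw [Set.iUnion₂_inter]
          exact ih _ (fun i => (hC i).inter (hC a)) (fun i => (hC' i).inter (hC' a)) n
        · obtain ⟨m, hm⟩ := Nat.exists_eq_succ_of_ne_zero hs.card_pos.ne'
          rw [hm, Nat.succ_sub_one, Nat.choose_succ_succ, add_comm]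

end Nerve
/-! ### Comparison with singular homology -/

section Bridge

lemma nonempty_homology_equiv (S : ShortComplex (ModuleCat ℚ)) {M₁ M₂ M₃ : Type*}
    [AddCommGroup M₁] [AddCommGroup M₂] [AddCommGroup M₃] [Module ℚ M₁] [Module ℚ M₂] [Module ℚ M₃]
    (i₁ : S.X₁ →ₗ[ℚ] M₁) (i₂ : S.X₂ →ₗ[ℚ] M₂) (i₃ : S.X₃ →ₗ[ℚ] M₃)
    (h₂ : Function.Injective i₂) (h₃ : Function.Injective i₃)
    (f : M₁ →ₗ[ℚ] M₂) (g : M₂ →ₗ[ℚ] M₃)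
    (hf : ∀ x, i₂ (S.f x) = f (i₁ x)) (hg : ∀ x, i₃ (S.g x) = g (i₂ x))
    (Z B : Submodule ℚ M₂) (hZ : Z = LinearMap.range i₂ ⊓ LinearMap.ker g)
    (hB : B = (LinearMap.range i₁).map f) :
    Nonempty (S.homology ≃ₗ[ℚ] Z ⧸ B.submoduleOf Z) := by
  subst hZ hB
  let φ : LinearMap.ker S.g.hom →ₗ[ℚ] ↥(LinearMap.range i₂ ⊓ LinearMap.ker g) :=
    (i₂ ∘ₗ (LinearMap.ker S.g.hom).subtype).codRestrict _ fun x => ⟨⟨x.1, rfl⟩, by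
      change g (i₂ x.1) = 0
      rw [← hg, show S.g x.1 = 0 from x.2, map_zero]⟩
  have hφ : Function.Bijective φ := by
    refine ⟨fun x y h => Subtype.ext (h₂ (congrArg Subtype.val h)), ?_⟩
    rintro ⟨_, ⟨x, rfl⟩, hx⟩
    refine ⟨⟨x, h₃ ?_⟩, rfl⟩
    exact (hg x).trans (hx.trans (map_zero i₃).symm)
  let e := LinearEquiv.ofBijective φ hφ
  refine ⟨S.moduleCatHomologyIso.toLinearEquiv ≪≫ₗ
    Submodule.Quotient.equiv (LinearMap.range S.moduleCatToCycles) _ e ?_⟩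
  ext ⟨z, hz⟩
  constructor
  · rintro ⟨_, ⟨x, rfl⟩, h⟩
    refine ⟨i₁ x, ⟨x, rfl⟩, ?_⟩
    rw [← hf]
    exact congrArg Subtype.val h
  · rintro ⟨_, ⟨x, rfl⟩, h⟩
    refine ⟨S.moduleCatToCycles x, ⟨x, rfl⟩, Subtype.ext ?_⟩
    exact (hf x).trans h

variable {E : Type} [TopologicalSpace E]

/-- Singular simplices of a subset as singular simplices of the ambient space. -/
def toAmbient (U : Set E) (n : ℕ) (x : (TopCat.toSSet.obj (TopCat.of U)).obj (.op ⟨n⟩)) :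
    C(Simp (n + 1), E) :=
  (ContinuousMap.mk Subtype.val continuous_subtype_val : C(U, E)).comp
    (TopCat.toSSetObjEquiv (TopCat.of U) (.op ⟨n⟩) x)

lemma toAmbient_injective (U : Set E) (n : ℕ) : Function.Injective (toAmbient U n) := by
  intro x y h
  refine (TopCat.toSSetObjEquiv (TopCat.of U) (.op ⟨n⟩)).injective (ContinuousMap.ext fun t => ?_)
  exact Subtype.ext (ContinuousMap.congr_fun h t)

lemma range_toAmbient (U : Set E) (n : ℕ) :
    Set.range (toAmbient U n) = {σ : C(Simp (n + 1), E) | ∀ t, σ t ∈ U} := by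
  ext σ
  constructor
  · rintro ⟨x, rfl⟩ t
    exact Subtype.property _
  · intro h
    refine ⟨(TopCat.toSSetObjEquiv (TopCat.of U) (.op ⟨n⟩)).symm
      ⟨fun t => ⟨σ t, h t⟩, σ.continuous.subtype_mk _⟩, ContinuousMap.ext fun t => ?_⟩
    simp [toAmbient]

lemma toAmbient_δ (U : Set E) (n : ℕ) (i : Fin (n + 2))
    (x : (TopCat.toSSet.obj (TopCat.of U)).obj (.op ⟨n + 1⟩)) :
    toAmbient U n ((TopCat.toSSet.obj (TopCat.of U)).δ i x) = face (toAmbient U (n + 1) x) i := by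
  refine ContinuousMap.ext fun t => ?_
  have h := TopCat.toSSetObjEquiv_δ_apply (X := TopCat.of U) x i t
  have ht : stdSimplex.map i.succAbove t = affineSimp (vertices (n + 2) ∘ i.succAbove) t := by
    refine Subtype.ext (funext fun j => ?_)
    refine (FunOnFinite.linearMap_apply_apply ℝ ℝ i.succAbove t.1 j).trans ?_
    simp [affineSimp, vertices, Pi.single_apply, Finset.sum_filter, eq_comm]
  rw [ht] at h
  exact congrArg Subtype.val h

/-- The inclusion of the singular chain complex of `U` into the ambient chains. -/
def chainInclusion (U : Set E) (n : ℕ) :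
    (singularChainComplexQ (TopCat.of U)).X n →ₗ[ℚ] SingChain E (n + 1) :=
  Finsupp.lmapDomain ℚ ℚ (toAmbient U n)

lemma chainInclusion_injective (U : Set E) (n : ℕ) : Function.Injective (chainInclusion U n) :=
  Finsupp.mapDomain_injective (toAmbient_injective U n)

lemma range_chainInclusion (U : Set E) (n : ℕ) :
    LinearMap.range (chainInclusion U n) = chainsIn (n + 1) U := by
  refine Eq.trans ?_ (congrArg (Finsupp.supported ℚ ℚ) (range_toAmbient U n))
  rw [← Set.image_univ, ← Finsupp.lmapDomain_supported, Finsupp.supported_univ, Submodule.map_top]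
  rfl

lemma alternating_free_map_single {X Y : Type} {m : ℕ} (f : Fin m → (X ⟶ Y)) (x : X) :
    (∑ i : Fin m, (-1 : ℤ) ^ (i : ℕ) • (ModuleCat.free ℚ).map (f i)).hom
        (Finsupp.single x (1 : ℚ)) =
      (∑ i : Fin m, Finsupp.single (f i x) ((-1 : ℚ) ^ (i : ℕ)) : Y →₀ ℚ) := by
  rw [ModuleCat.hom_sum]
  refine (LinearMap.sum_apply _ _ _).trans ?_
  refine Finset.sum_congr rfl fun i _ => ?_
  rw [ModuleCat.hom_zsmul]
  refine (LinearMap.smul_apply _ _ _).trans ?_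
  refine (congrArg ((-1 : ℤ) ^ (i : ℕ) • ·) (ModuleCat.free_map_apply (R := ℚ) (f i) x)).trans ?_
  change (-1 : ℤ) ^ (i : ℕ) • (Finsupp.single (f i x) (1 : ℚ)) = _
  rw [Finsupp.smul_single]
  simp

lemma chainInclusion_d (U : Set E) (n : ℕ) (x : (singularChainComplexQ (TopCat.of U)).X (n + 1)) :
    chainInclusion U n ((singularChainComplexQ (TopCat.of U)).d (n + 1) n x) =
      singBoundary E (n + 1) (chainInclusion U (n + 1) x) := by
  suffices h : chainInclusion U n ∘ₗ ((singularChainComplexQ (TopCat.of U)).d (n + 1) n).hom =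
      singBoundary E (n + 1) ∘ₗ chainInclusion U (n + 1) from LinearMap.congr_fun h x
  refine Finsupp.lhom_ext' fun σ => LinearMap.ext_ring ?_
  have h1 : ((singularChainComplexQ (TopCat.of U)).d (n + 1) n).hom (Finsupp.single σ (1 : ℚ)) =
      (∑ i : Fin (n + 2), Finsupp.single ((TopCat.toSSet.obj (TopCat.of U)).δ i σ)
        ((-1 : ℚ) ^ (i : ℕ)) : (TopCat.toSSet.obj (TopCat.of U)).obj (.op ⟨n⟩) →₀ ℚ) :=
    (LinearMap.congr_fun (congrArg ModuleCat.Hom.hom (alternatingFaceMapComplex_obj_d _ n)) _).trans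
      (alternating_free_map_single (fun i => (TopCat.toSSet.obj (TopCat.of U)).δ i) σ)
  have h2 : chainInclusion U (n + 1) (Finsupp.single σ (1 : ℚ)) =
      Finsupp.single (toAmbient U (n + 1) σ) 1 := Finsupp.mapDomain_single
  refine (congrArg (chainInclusion U n) h1).trans ?_
  refine Eq.trans ?_ (congrArg (singBoundary E (n + 1)) h2).symm
  rw [singBoundary_single]
  refine (map_sum (Finsupp.lmapDomain ℚ ℚ (toAmbient U n)) _ _).trans ?_
  refine Finset.sum_congr rfl fun i _ => ?_
  rw [Finsupp.lmapDomain_apply, Finsupp.mapDomain_single, toAmbient_δ]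

lemma nonempty_homology_equiv_cycles (U : Set E) (k : ℕ) :
    Nonempty ((singularChainComplexQ (TopCat.of U)).homology (k + 1) ≃ₗ[ℚ]
      cycles (k + 2) U ⧸ (boundaries (k + 2) U).submoduleOf (cycles (k + 2) U)) := by
  set K := singularChainComplexQ (TopCat.of U)
  obtain ⟨e⟩ := nonempty_homology_equiv (K.sc' (k + 2) (k + 1) k) (chainInclusion U (k + 2))
    (chainInclusion U (k + 1)) (chainInclusion U k) (chainInclusion_injective U _)
    (chainInclusion_injective U _) (singBoundary E (k + 2)) (singBoundary E (k + 1))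
    (chainInclusion_d U (k + 1)) (chainInclusion_d U k) (cycles (k + 2) U) (boundaries (k + 2) U)
    (congrArg (· ⊓ LinearMap.ker (singBoundary E (k + 1))) (range_chainInclusion U (k + 1)).symm)
    (congrArg (Submodule.map (singBoundary E (k + 2))) (range_chainInclusion U (k + 2)).symm)
  exact ⟨(ShortComplex.homologyMapIso (K.isoSc' (k + 2) (k + 1) k (by simp) (by simp))).toLinearEquiv
    ≪≫ₗ e⟩

/-- The Betti number of a subset in terms of ambient chains. -/
def betti (n : ℕ) (U : Set E) : ℕ :=
  Module.finrank ℚ (cycles n U ⧸ (boundaries n U).submoduleOf (cycles n U))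

lemma bettiTop_eq_betti (U : Set E) (k : ℕ) :
    bettiTop (TopCat.of U) (k + 1) = betti (k + 2) U :=
  (nonempty_homology_equiv_cycles U k).some.finrank_eq

end Bridge
/-! ### Finiteness and additivity of Betti numbers -/

section Betti

lemma nonempty_quotient_equiv_map {M : Type*} [AddCommGroup M] [Module ℚ M]
    (Z B B' : Submodule ℚ M) (h : ∀ z ∈ Z, z ∈ B' ↔ z ∈ B) :
    Nonempty ((Z ⧸ B.submoduleOf Z) ≃ₗ[ℚ] Z.map B'.mkQ) := by
  let f := B'.mkQ ∘ₗ Z.subtype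
  have hk : LinearMap.ker f = B.submoduleOf Z := by
    ext ⟨z, hz⟩
    rw [LinearMap.mem_ker, LinearMap.comp_apply, Submodule.mkQ_apply,
      Submodule.Quotient.mk_eq_zero]
    exact h z hz
  have hr : LinearMap.range f = Z.map B'.mkQ := by
    rw [LinearMap.range_comp, Submodule.range_subtype]
  exact ⟨(Submodule.quotEquivOfEq _ _ hk).symm ≪≫ₗ f.quotKerEquivRange ≪≫ₗ
    LinearEquiv.ofEq _ _ hr⟩

variable {E : Type} [TopologicalSpace E] {n : ℕ}

lemma HomologyBound.finite_and_betti_le {U : Set E} {m : ℕ} (h : HomologyBound n U m) :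
    Module.Finite ℚ (cycles n U ⧸ (boundaries n U).submoduleOf (cycles n U)) ∧
      betti n U ≤ m := by
  obtain ⟨W, hW, hWm, hle⟩ := h
  obtain ⟨e⟩ := nonempty_quotient_equiv_map (cycles n U) (boundaries n U) (boundaries n U)
    fun _ _ => Iff.rfl
  have hle' : (cycles n U).map (boundaries n U).mkQ ≤ W.map (boundaries n U).mkQ := by
    refine (Submodule.map_mono hle).trans ?_
    rw [Submodule.map_sup, Submodule.mkQ_map_self, sup_bot_eq]
  have hfin : Module.Finite ℚ ((cycles n U).map (boundaries n U).mkQ) :=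
    Submodule.finiteDimensional_of_le hle'
  refine ⟨Module.Finite.equiv e.symm, ?_⟩
  rw [betti, e.finrank_eq]
  exact (Submodule.finrank_mono hle').trans ((Submodule.finrank_map_le _ _).trans hWm)

variable {A B : Set E}

lemma chainsIn_union (hA : IsOpen A) (hB : IsOpen B) (hAB : Disjoint A B) :
    chainsIn (n + 1) (A ∪ B) = chainsIn (n + 1) A ⊔ chainsIn (n + 1) B := by
  refine le_antisymm (chainsIn_le_iff.2 fun σ hσ => ?_)
    (sup_le (chainsIn_mono Set.subset_union_left) (chainsIn_mono Set.subset_union_right))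
  have hc : IsPreconnected (Set.range σ) := isPreconnected_range σ.continuous
  rcases hc.subset_or_subset hA hB hAB (Set.range_subset_iff.2 hσ) with h | h
  · exact Submodule.mem_sup_left (single_mem_chainsIn (fun t => h ⟨t, rfl⟩) 1)
  · exact Submodule.mem_sup_right (single_mem_chainsIn (fun t => h ⟨t, rfl⟩) 1)

lemma chainsIn_inf_eq_bot (hAB : Disjoint A B) :
    chainsIn (n + 1) A ⊓ chainsIn (n + 1) B = ⊥ := by
  rw [chainsIn_inf, hAB.inter_eq, chainsIn_succ_empty]

lemma cycles_union (hA : IsOpen A) (hB : IsOpen B) (hAB : Disjoint A B) :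
    cycles (n + 2) (A ∪ B) = cycles (n + 2) A ⊔ cycles (n + 2) B := by
  refine le_antisymm (fun z hz => ?_) (sup_le (cycles_mono Set.subset_union_left _)
    (cycles_mono Set.subset_union_right _))
  obtain ⟨hz, hz0⟩ := mem_cycles_succ.1 hz
  rw [chainsIn_union hA hB hAB] at hz
  obtain ⟨a, ha, b, hb, rfl⟩ := Submodule.mem_sup.1 hz
  rw [map_add] at hz0
  have ha0 : singBoundary E (n + 1) a = 0 := by
    rw [← Submodule.mem_bot ℚ, ← chainsIn_inf_eq_bot (n := n) hAB]
    refine ⟨singBoundary_mem_chainsIn ha, ?_⟩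
    rw [eq_neg_of_add_eq_zero_left hz0]
    exact neg_mem (singBoundary_mem_chainsIn hb)
  rw [ha0, zero_add] at hz0
  exact Submodule.add_mem_sup ⟨ha, ha0⟩ ⟨hb, hz0⟩

lemma boundaries_union (hA : IsOpen A) (hB : IsOpen B) (hAB : Disjoint A B) :
    boundaries n (A ∪ B) = boundaries n A ⊔ boundaries n B := by
  rw [boundaries, chainsIn_union hA hB hAB, Submodule.map_sup, boundaries, boundaries]

lemma mem_boundaries_union_iff (hA : IsOpen A) (hB : IsOpen B) (hAB : Disjoint A B)
    {z : SingChain E (n + 1)} (hz : z ∈ chainsIn (n + 1) A) :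
    z ∈ boundaries (n + 1) (A ∪ B) ↔ z ∈ boundaries (n + 1) A := by
  refine ⟨fun h => ?_, fun h => boundaries_mono Set.subset_union_left h⟩
  rw [boundaries_union hA hB hAB] at h
  obtain ⟨a, ha, b, hb, rfl⟩ := Submodule.mem_sup.1 h
  have hin : ∀ {U : Set E}, boundaries (n + 1) U ≤ chainsIn (n + 1) U := fun {U} =>
    (boundaries_le_cycles _ U).trans (cycles_le_chainsIn _ U)
  have hb0 : b = 0 := by
    rw [← Submodule.mem_bot ℚ, ← chainsIn_inf_eq_bot (n := n) hAB]
    exact ⟨by simpa using sub_mem hz (hin ha), hin hb⟩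
  simpa [hb0] using ha

lemma betti_union (hA : IsOpen A) (hB : IsOpen B) (hAB : Disjoint A B) {a b : ℕ}
    (hbA : HomologyBound (n + 2) A a) (hbB : HomologyBound (n + 2) B b) :
    betti (n + 2) (A ∪ B) = betti (n + 2) A + betti (n + 2) B := by
  set D := boundaries (n + 2) (A ∪ B) with hD
  obtain ⟨eA⟩ := nonempty_quotient_equiv_map (cycles (n + 2) A) (boundaries (n + 2) A) D
    fun z hz => mem_boundaries_union_iff hA hB hAB (cycles_le_chainsIn _ _ hz)
  obtain ⟨eB⟩ := nonempty_quotient_equiv_map (cycles (n + 2) B) (boundaries (n + 2) B) D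
    fun z hz => by
      rw [hD, Set.union_comm]
      exact mem_boundaries_union_iff hB hA hAB.symm (cycles_le_chainsIn _ _ hz)
  obtain ⟨e⟩ := nonempty_quotient_equiv_map (cycles (n + 2) (A ∪ B)) D D fun _ _ => Iff.rfl
  have := hbA.finite_and_betti_le.1
  have := hbB.finite_and_betti_le.1
  have := Module.Finite.equiv eA
  have := Module.Finite.equiv eB
  rw [betti, betti, betti, e.finrank_eq, eA.finrank_eq, eB.finrank_eq,
    ← Submodule.finrank_sup_add_finrank_inf_eq, ← Submodule.map_sup, ← cycles_union hA hB hAB]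
  suffices h : (cycles (n + 2) A).map D.mkQ ⊓ (cycles (n + 2) B).map D.mkQ = ⊥ by
    rw [h, finrank_bot, add_zero]
  rw [Submodule.eq_bot_iff]
  rintro _ ⟨⟨x, hx, rfl⟩, ⟨y, hy, hxy⟩⟩
  rw [Submodule.mkQ_apply, Submodule.mkQ_apply, Submodule.Quotient.eq, hD,
    boundaries_union hA hB hAB] at hxy
  obtain ⟨u, hu, v, hv, huv⟩ := Submodule.mem_sup.1 hxy
  have hin : ∀ {U : Set E}, boundaries (n + 2) U ≤ chainsIn (n + 2) U := fun {U} =>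
    (boundaries_le_cycles _ U).trans (cycles_le_chainsIn _ U)
  have h0 : x + u = 0 := by
    rw [← Submodule.mem_bot ℚ, ← chainsIn_inf_eq_bot (n := n + 1) hAB]
    refine ⟨add_mem (cycles_le_chainsIn _ _ hx) (hin hu), ?_⟩
    have : x + u = y - v := by rw [eq_sub_iff_add_eq, add_assoc, huv, add_sub_cancel]
    rw [this]
    exact sub_mem (cycles_le_chainsIn _ _ hy) (hin hv)
  rw [Submodule.mkQ_apply, Submodule.Quotient.mk_eq_zero, eq_neg_of_add_eq_zero_left h0]
  exact neg_mem (boundaries_mono Set.subset_union_left hu)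

end Betti
/-! ### Unions of balls around finite sets of points -/

section Cech

variable {d : ℕ} {t : ℝ}

local notation "𝔼" => EuclideanSpace ℝ (Fin d)

lemma isOpen_cechBody (Y : Set 𝔼) (t : ℝ) : IsOpen (cechBody Y t) :=
  isOpen_biUnion fun _ _ => Metric.isOpen_ball

lemma cechBody_union (Y Z : Set 𝔼) (t : ℝ) :
    cechBody (Y ∪ Z) t = cechBody Y t ∪ cechBody Z t :=
  Set.biUnion_union Y Z _

lemma cechBody_mono {Y Z : Set 𝔼} (h : Y ⊆ Z) (t : ℝ) : cechBody Y t ⊆ cechBody Z t :=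
  Set.biUnion_subset_biUnion_left h

lemma mem_cechBody_of_mem (ht : 0 < t) {Y : Set 𝔼} {y : 𝔼} (hy : y ∈ Y) : y ∈ cechBody Y t :=
  Set.mem_biUnion hy (Metric.mem_ball_self (half_pos ht))

lemma disjoint_of_disjoint_cechBody (ht : 0 < t) {Y Z : Set 𝔼}
    (h : Disjoint (cechBody Y t) (cechBody Z t)) : Disjoint Y Z :=
  Set.disjoint_left.2 fun _ hy hz =>
    Set.disjoint_left.1 h (mem_cechBody_of_mem ht hy) (mem_cechBody_of_mem ht hz)

lemma nonempty_of_cechConnected {Y : Set 𝔼} (h : cechConnected Y t) : Y.Nonempty := by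
  obtain ⟨x, hx⟩ := h.nonempty
  obtain ⟨y, hy, -⟩ := Set.mem_iUnion₂.1 hx
  exact ⟨y, hy⟩

lemma subset_or_subset_of_cechConnected (ht : 0 < t) {S Y Z : Set 𝔼} (hS : cechConnected S t)
    (h : Disjoint (cechBody Y t) (cechBody Z t)) (hSYZ : S ⊆ Y ∪ Z) : S ⊆ Y ∨ S ⊆ Z := by
  have hsub := cechBody_mono hSYZ t
  rw [cechBody_union] at hsub
  rcases hS.isPreconnected.subset_or_subset (isOpen_cechBody Y t) (isOpen_cechBody Z t) h hsub
    with h' | h'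
  · refine Or.inl fun x hx => (hSYZ hx).resolve_right fun hz => ?_
    exact Set.disjoint_left.1 h (h' (mem_cechBody_of_mem ht hx)) (mem_cechBody_of_mem ht hz)
  · refine Or.inr fun x hx => (hSYZ hx).resolve_left fun hz => ?_
    exact Set.disjoint_left.1 h (mem_cechBody_of_mem ht hz) (h' (mem_cechBody_of_mem ht hx))

lemma eq_of_cechConnected_of_disjoint (ht : 0 < t) {S Y : Set 𝔼} (hY : cechConnected Y t)
    (hS : S.Nonempty) (hSY : S ⊆ Y) (h : Disjoint (cechBody S t) (cechBody (Y \ S) t)) :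
    S = Y := by
  refine hSY.antisymm ?_
  rcases subset_or_subset_of_cechConnected ht hY h (Set.union_sdiff_cancel hSY).ge with h' | h'
  · exact h'
  · obtain ⟨x, hx⟩ := hS
    exact ((h' (hSY hx)).2 hx).elim

lemma exists_split (ht : 0 < t) {Y : Finset 𝔼} (hne : Y.Nonempty)
    (hY : ¬ cechConnected (Y : Set 𝔼) t) :
    ∃ D D' : Finset 𝔼, D ⊂ Y ∧ D' ⊂ Y ∧ (D : Set 𝔼) ∪ D' = Y ∧
      Disjoint (cechBody (D : Set 𝔼) t) (cechBody (D' : Set 𝔼) t) := by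
  classical
  have hpre : ¬ _root_.IsPreconnected (cechBody (Y : Set 𝔼) t) := fun h => by
    obtain ⟨y, hy⟩ := hne
    exact hY ⟨⟨y, mem_cechBody_of_mem ht hy⟩, h⟩
  unfold _root_.IsPreconnected at hpre
  push Not at hpre
  obtain ⟨u, v, hu, hv, huv, ⟨x, hx⟩, ⟨x', hx'⟩, hem⟩ := hpre
  set B := cechBody (Y : Set 𝔼) t with hB
  have hBo : IsOpen B := isOpen_cechBody _ t
  have hdis : Disjoint (B ∩ u) (B ∩ v) := by
    rw [Set.disjoint_iff_inter_eq_empty, ← hem]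
    ext; simp; tauto
  have hball : ∀ y ∈ Y, Metric.ball y (t / 2) ⊆ B ∩ u ∨ Metric.ball y (t / 2) ⊆ B ∩ v := by
    intro y hy
    refine (convex_ball y (t / 2)).isPreconnected.subset_or_subset (hBo.inter hu) (hBo.inter hv)
      hdis ?_
    rw [← Set.inter_union_distrib_left, Set.inter_eq_left.2 huv]
    exact Set.subset_biUnion_of_mem (u := fun y => Metric.ball y (t / 2)) (Finset.mem_coe.2 hy)
  have hcover : ∀ {w w' : Set 𝔼}, Disjoint (B ∩ w) (B ∩ w') → (∃ x, x ∈ B ∩ w') →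
      Y.filter (fun y => Metric.ball y (t / 2) ⊆ B ∩ w) ⊂ Y := by
    intro w w' hd ⟨x, hx⟩
    obtain ⟨y, hy, hxy⟩ := Set.mem_iUnion₂.1 hx.1
    refine (Finset.filter_ssubset).2 ⟨y, hy, fun h => ?_⟩
    exact Set.disjoint_left.1 hd (h hxy) hx
  have hbody : ∀ w : Set 𝔼, cechBody
      ((Y.filter (fun y => Metric.ball y (t / 2) ⊆ B ∩ w) : Finset 𝔼) : Set 𝔼) t ⊆ B ∩ w := by
    intro w
    refine Set.iUnion₂_subset fun y hy => ?_
    exact (Finset.mem_filter.1 (Finset.mem_coe.1 hy)).2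
  refine ⟨Y.filter fun y => Metric.ball y (t / 2) ⊆ B ∩ u,
    Y.filter fun y => Metric.ball y (t / 2) ⊆ B ∩ v, hcover hdis ⟨x', hx'⟩,
    hcover hdis.symm ⟨x, hx⟩, ?_, hdis.mono (hbody u) (hbody v)⟩
  rw [← Finset.coe_union, ← Finset.filter_or]
  exact congrArg _ (Finset.filter_true_of_mem hball)

lemma exists_cechConnected_insert (ht : 0 < t) {S Y : Finset 𝔼}
    (hS : cechConnected (S : Set 𝔼) t) (hY : cechConnected (Y : Set 𝔼) t) (hSY : S ⊂ Y) :
    ∃ T : Finset 𝔼, S ⊆ T ∧ T ⊆ Y ∧ T.card = S.card + 1 ∧ cechConnected (T : Set 𝔼) t := by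
  classical
  have h : ¬ Disjoint (cechBody (S : Set 𝔼) t) (cechBody ((Y : Set 𝔼) \ S) t) := fun h =>
    hSY.ne (Finset.coe_injective (eq_of_cechConnected_of_disjoint ht hY
      (nonempty_of_cechConnected hS)
      (Finset.coe_subset.2 hSY.subset) h))
  obtain ⟨x, hxS, hx⟩ := Set.not_disjoint_iff.1 h
  obtain ⟨y, ⟨hyY, hyS⟩, hxy⟩ := Set.mem_iUnion₂.1 hx
  refine ⟨insert y S, Finset.subset_insert y S, Finset.insert_subset hyY hSY.subset,
    Finset.card_insert_of_notMem hyS, ?_⟩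
  have hu : cechBody ((insert y S : Finset 𝔼) : Set 𝔼) t =
      Metric.ball y (t / 2) ∪ cechBody (S : Set 𝔼) t := by
    rw [Finset.coe_insert]
    exact Set.biUnion_insert y _ _
  rw [cechConnected, hu]
  exact IsConnected.union ⟨x, hxy, hxS⟩ ⟨⟨x, hxy⟩, (convex_ball y (t / 2)).isPreconnected⟩ hS

lemma exists_cechConnected_superset (ht : 0 < t) {Y : Finset 𝔼} (hY : cechConnected (Y : Set 𝔼) t)
    {S : Finset 𝔼} (hS : cechConnected (S : Set 𝔼) t) (hSY : S ⊆ Y) {N : ℕ} (hSN : S.card ≤ N)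
    (hNY : N ≤ Y.card) :
    ∃ T : Finset 𝔼, S ⊆ T ∧ T ⊆ Y ∧ T.card = N ∧ cechConnected (T : Set 𝔼) t := by
  induction N, hSN using Nat.le_induction with
  | base => exact ⟨S, subset_rfl, hSY, rfl, hS⟩
  | succ N _ ih =>
    obtain ⟨T, hST, hTY, hT, hTc⟩ := ih (Nat.le_of_succ_le hNY)
    obtain ⟨T', h1, h2, h3, h4⟩ := exists_cechConnected_insert ht hTc hY
      (Finset.ssubset_iff_subset_ne.2 ⟨hTY, by rintro rfl; omega⟩)
    exact ⟨T', hST.trans h1, h2, by omega, h4⟩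

lemma cechConnected_of_mem_nerveFaces {Y S : Finset 𝔼} {n : ℕ}
    (hS : S ∈ nerveFaces (fun y => Metric.ball y (t / 2)) Y (n + 1)) :
    cechConnected (S : Set 𝔼) t := by
  obtain ⟨⟨-, hcard⟩, x, hx⟩ := mem_nerveFaces.1 hS
  rw [Set.mem_iInter₂] at hx
  have hne : S.Nonempty := Finset.card_pos.1 (by omega)
  refine (StarConvex.isPathConnected (a := x) ?_ ?_).isConnected
  · exact starConvex_iUnion₂ fun y hy => (convex_ball y (t / 2)).starConvex (hx y hy)
  · obtain ⟨y, hy⟩ := hne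
    exact Set.mem_biUnion (Finset.mem_coe.2 hy) (hx y hy)

open Classical in
/-- The `i`-point subsets counted by `Jcount`. -/
def isolatedSets (k : ℕ) (Y : Finset 𝔼) (t : ℝ) (i j : ℕ) : Finset (Finset 𝔼) :=
  Y.powerset.filter fun S => S.card = i ∧ cechConnected (S : Set 𝔼) t ∧
    cechBetti (S : Set 𝔼) t k = j ∧
      Disjoint (cechBody (S : Set 𝔼) t) (cechBody ((Y : Set 𝔼) \ S) t)

open Classical in
/-- The `i`-point subsets counted by `Lcount`. -/
def connectedSets (Y : Finset 𝔼) (t : ℝ) (i : ℕ) : Finset (Finset 𝔼) :=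
  Y.powerset.filter fun S => S.card = i ∧ cechConnected (S : Set 𝔼) t

lemma mem_isolatedSets {k i j : ℕ} {Y S : Finset 𝔼} : S ∈ isolatedSets k Y t i j ↔ S ⊆ Y ∧
    S.card = i ∧ cechConnected (S : Set 𝔼) t ∧ cechBetti (S : Set 𝔼) t k = j ∧
      Disjoint (cechBody (S : Set 𝔼) t) (cechBody ((Y : Set 𝔼) \ S) t) := by
  simp only [isolatedSets, Finset.mem_filter, Finset.mem_powerset]

lemma mem_connectedSets {i : ℕ} {Y S : Finset 𝔼} : S ∈ connectedSets Y t i ↔ S ⊆ Y ∧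
    S.card = i ∧ cechConnected (S : Set 𝔼) t := by
  simp only [connectedSets, Finset.mem_filter, Finset.mem_powerset]

lemma Jcount_coe (k : ℕ) (Y : Finset 𝔼) (t : ℝ) (i j : ℕ) :
    Jcount k (Y : Set 𝔼) t i j = (isolatedSets k Y t i j).card := by
  rw [Jcount, ← Set.ncard_coe_finset]
  congr 1
  ext S
  rw [Finset.mem_coe, mem_isolatedSets, Set.mem_ofPred_eq, Finset.coe_subset]

lemma Lcount_coe (Y : Finset 𝔼) (t : ℝ) (i : ℕ) :
    Lcount (Y : Set 𝔼) t i = (connectedSets Y t i).card := by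
  rw [Lcount, ← Set.ncard_coe_finset]
  congr 1
  ext S
  rw [Finset.mem_coe, mem_connectedSets, Set.mem_ofPred_eq, Finset.coe_subset]

lemma homologyBound_cechBody_nerveFaces (Y : Finset 𝔼) (t : ℝ) (n : ℕ) :
    HomologyBound n (cechBody (Y : Set 𝔼) t)
      (nerveFaces (fun y : 𝔼 => Metric.ball y (t / 2)) Y n).card :=
  homologyBound_nerveFaces Y _ (fun _ => Metric.isOpen_ball) (fun y => convex_ball y _) n

lemma homologyBound_cechBody_choose (Y : Finset 𝔼) (t : ℝ) (n : ℕ) :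
    HomologyBound n (cechBody (Y : Set 𝔼) t) ((Y.card - 1).choose n) :=
  homologyBound_choose Y _ (fun _ => Metric.isOpen_ball) (fun y => convex_ball y _) n

lemma cechBetti_le_choose (Y : Finset 𝔼) (t : ℝ) (k : ℕ) :
    cechBetti (Y : Set 𝔼) t (k + 1) ≤ (Y.card - 1).choose (k + 2) := by
  rw [cechBetti, bettiTop_eq_betti]
  exact (homologyBound_cechBody_choose Y t _).finite_and_betti_le.2

lemma cechBetti_le_card_nerveFaces (Y : Finset 𝔼) (t : ℝ) (k : ℕ) :
    cechBetti (Y : Set 𝔼) t (k + 1) ≤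
      (nerveFaces (fun y : 𝔼 => Metric.ball y (t / 2)) Y (k + 2)).card := by
  rw [cechBetti, bettiTop_eq_betti]
  exact (homologyBound_cechBody_nerveFaces Y t _).finite_and_betti_le.2

lemma cechBetti_union {D D' Y : Finset 𝔼} (hY : (D : Set 𝔼) ∪ D' = Y)
    (h : Disjoint (cechBody (D : Set 𝔼) t) (cechBody (D' : Set 𝔼) t)) (k : ℕ) :
    cechBetti (Y : Set 𝔼) t (k + 1) =
      cechBetti (D : Set 𝔼) t (k + 1) + cechBetti (D' : Set 𝔼) t (k + 1) := by
  rw [← hY, cechBetti, cechBetti, cechBetti, bettiTop_eq_betti, bettiTop_eq_betti,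
    bettiTop_eq_betti, cechBody_union]
  exact betti_union (isOpen_cechBody _ _) (isOpen_cechBody _ _) h
    (homologyBound_cechBody_choose D t _) (homologyBound_cechBody_choose D' t _)

lemma disjoint_connectedSets (ht : 0 < t) {D D' : Finset 𝔼}
    (h : Disjoint (cechBody (D : Set 𝔼) t) (cechBody (D' : Set 𝔼) t)) (i : ℕ) :
    Disjoint (connectedSets D t i) (connectedSets D' t i) := by
  rw [Finset.disjoint_left]
  intro S hS hS'
  rw [mem_connectedSets] at hS hS'
  obtain ⟨x, hx⟩ := nonempty_of_cechConnected hS.2.2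
  exact Set.disjoint_left.1 (disjoint_of_disjoint_cechBody ht h) (hS.1 hx) (hS'.1 hx)

lemma card_connectedSets_add_le (ht : 0 < t) {D D' Y : Finset 𝔼} (hY : (D : Set 𝔼) ∪ D' = Y)
    (h : Disjoint (cechBody (D : Set 𝔼) t) (cechBody (D' : Set 𝔼) t)) (i : ℕ) :
    (connectedSets D t i).card + (connectedSets D' t i).card ≤ (connectedSets Y t i).card := by
  classical
  rw [← Finset.card_union_of_disjoint (disjoint_connectedSets ht h i)]
  have hD : D ⊆ Y := Finset.coe_subset.1 (hY ▸ Set.subset_union_left)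
  have hD' : D' ⊆ Y := Finset.coe_subset.1 (hY ▸ Set.subset_union_right)
  refine Finset.card_le_card (Finset.union_subset (fun S hS => ?_) fun S hS => ?_) <;>
    rw [mem_connectedSets] at hS ⊢
  exacts [⟨hS.1.trans hD, hS.2⟩, ⟨hS.1.trans hD', hS.2⟩]

lemma mem_isolatedSets_of_subset {D D' Y S : Finset 𝔼} (hY : (D : Set 𝔼) ∪ D' = Y)
    (h : Disjoint (cechBody (D : Set 𝔼) t) (cechBody (D' : Set 𝔼) t)) (hSD : S ⊆ D) {k i j : ℕ} :
    S ∈ isolatedSets k Y t i j ↔ S ∈ isolatedSets k D t i j := by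
  have hDY : (D : Set 𝔼) ⊆ Y := hY ▸ Set.subset_union_left
  have hiff : Disjoint (cechBody (S : Set 𝔼) t) (cechBody ((Y : Set 𝔼) \ S) t) ↔
      Disjoint (cechBody (S : Set 𝔼) t) (cechBody ((D : Set 𝔼) \ S) t) := by
    refine ⟨fun h' => h'.mono_right (cechBody_mono (Set.sdiff_subset_sdiff_left hDY) t),
      fun h' => ?_⟩
    have hsub : (Y : Set 𝔼) \ S ⊆ ((D : Set 𝔼) \ S) ∪ D' := by
      rw [← hY]
      rintro x ⟨hx | hx, hxS⟩
      exacts [Or.inl ⟨hx, hxS⟩, Or.inr hx]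
    refine Disjoint.mono_right ((cechBody_mono hsub t).trans (cechBody_union _ _ t).le) ?_
    exact Set.disjoint_union_right.2 ⟨h', h.mono_left (cechBody_mono (Finset.coe_subset.2 hSD) t)⟩
  rw [mem_isolatedSets, mem_isolatedSets, hiff]
  simp only [hSD, hSD.trans (Finset.coe_subset.1 hDY), true_and]

lemma card_isolatedSets_union (ht : 0 < t) {D D' Y : Finset 𝔼} (hY : (D : Set 𝔼) ∪ D' = Y)
    (h : Disjoint (cechBody (D : Set 𝔼) t) (cechBody (D' : Set 𝔼) t)) (k i j : ℕ) :
    (isolatedSets k Y t i j).card =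
      (isolatedSets k D t i j).card + (isolatedSets k D' t i j).card := by
  classical
  have hle : ∀ Z : Finset 𝔼, isolatedSets k Z t i j ⊆ connectedSets Z t i := fun Z S hS => by
    rw [mem_isolatedSets] at hS
    exact mem_connectedSets.2 ⟨hS.1, hS.2.1, hS.2.2.1⟩
  rw [← Finset.card_union_of_disjoint ((disjoint_connectedSets ht h i).mono (hle D) (hle D'))]
  congr 1
  have hY' : (D' : Set 𝔼) ∪ D = Y := by rw [Set.union_comm, hY]
  ext S
  rw [Finset.mem_union]
  constructor
  · intro hS
    have hS' := mem_isolatedSets.1 hS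
    rcases subset_or_subset_of_cechConnected ht hS'.2.2.1 h
        (hY ▸ Finset.coe_subset.2 hS'.1) with h' | h'
    · exact Or.inl ((mem_isolatedSets_of_subset hY h (Finset.coe_subset.1 h')).1 hS)
    · exact Or.inr ((mem_isolatedSets_of_subset hY' h.symm (Finset.coe_subset.1 h')).1 hS)
  · rintro (hS | hS)
    · exact (mem_isolatedSets_of_subset hY h (mem_isolatedSets.1 hS).1).2 hS
    · exact (mem_isolatedSets_of_subset hY' h.symm (mem_isolatedSets.1 hS).1).2 hS

lemma card_nerveFaces_le_choose_mul (ht : 0 < t) {Y : Finset 𝔼} (hY : cechConnected (Y : Set 𝔼) t)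
    {n N : ℕ} (hn : n + 1 ≤ N) (hN : N ≤ Y.card) :
    (nerveFaces (fun y : 𝔼 => Metric.ball y (t / 2)) Y (n + 1)).card ≤
      N.choose (n + 1) * (connectedSets Y t N).card := by
  classical
  have hsub : nerveFaces (fun y : 𝔼 => Metric.ball y (t / 2)) Y (n + 1) ⊆
      (connectedSets Y t N).biUnion fun T => T.powersetCard (n + 1) := by
    intro S hS
    have hS' := (mem_nerveFaces.1 hS).1
    obtain ⟨T, h1, h2, h3, h4⟩ := exists_cechConnected_superset ht hY
      (cechConnected_of_mem_nerveFaces hS) hS'.1 (hS'.2.trans_le hn) hN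
    exact Finset.mem_biUnion.2 ⟨T, mem_connectedSets.2 ⟨h2, h3, h4⟩,
      Finset.mem_powersetCard.2 ⟨h1, hS'.2⟩⟩
  refine (Finset.card_le_card hsub).trans ?_
  rw [mul_comm]
  refine Finset.card_biUnion_le_card_mul _ _ _ fun T hT => ?_
  rw [Finset.card_powersetCard, (mem_connectedSets.1 hT).2.1]

lemma isolatedSets_subset_singleton (ht : 0 < t) {Y : Finset 𝔼} (hY : cechConnected (Y : Set 𝔼) t)
    (k i j : ℕ) : isolatedSets k Y t i j ⊆ {Y} := by
  intro S hS
  obtain ⟨hSY, -, hc, -, hdis⟩ := mem_isolatedSets.1 hS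
  rw [Finset.mem_singleton]
  exact Finset.coe_injective (eq_of_cechConnected_of_disjoint ht hY (nonempty_of_cechConnected hc)
    (Finset.coe_subset.2 hSY) hdis)

lemma mem_isolatedSets_self {k : ℕ} {Y : Finset 𝔼} (hY : cechConnected (Y : Set 𝔼) t) :
    Y ∈ isolatedSets k Y t Y.card (cechBetti (Y : Set 𝔼) t k) :=
  mem_isolatedSets.2 ⟨subset_rfl, rfl, hY, rfl, by simp [cechBody, ballsAround]⟩

lemma cechBetti_bounds_of_cechConnected (ht : 0 < t) {Y : Finset 𝔼}
    (hY : cechConnected (Y : Set 𝔼) t) (k : ℕ) :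
    (isolatedSets (k + 1) Y t (k + 3) 1).card ≤ cechBetti (Y : Set 𝔼) t (k + 1) ∧
      cechBetti (Y : Set 𝔼) t (k + 1) ≤ (isolatedSets (k + 1) Y t (k + 3) 1).card +
        (k + 4).choose (k + 2) * (connectedSets Y t (k + 4)).card := by
  have hsub := isolatedSets_subset_singleton ht hY (k + 1) (k + 3) 1
  constructor
  · obtain hem | ⟨S, hS⟩ := (isolatedSets (k + 1) Y t (k + 3) 1).eq_empty_or_nonempty
    · simp [hem]
    · obtain rfl := Finset.mem_singleton.1 (hsub hS)
      rw [(mem_isolatedSets.1 hS).2.2.2.1]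
      simpa using Finset.card_le_card hsub
  · have hle := cechBetti_le_choose Y t k
    rcases lt_trichotomy Y.card (k + 3) with h | h | h
    · rw [Nat.choose_eq_zero_of_lt (by omega)] at hle
      omega
    · rw [h, show k + 3 - 1 = k + 2 from rfl, Nat.choose_self] at hle
      refine le_add_right ?_
      interval_cases hb : cechBetti (Y : Set 𝔼) t (k + 1)
      · exact Nat.zero_le _
      · have hmem := mem_isolatedSets_self (k := k + 1) hY
        rw [h, hb] at hmem
        exact Finset.card_pos.2 ⟨Y, hmem⟩
    · exact le_add_left ((cechBetti_le_card_nerveFaces Y t k).trans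
        (card_nerveFaces_le_choose_mul ht hY (by omega) h))

lemma cechBetti_bounds (ht : 0 < t) (k : ℕ) (Y : Finset 𝔼) :
    (isolatedSets (k + 1) Y t (k + 3) 1).card ≤ cechBetti (Y : Set 𝔼) t (k + 1) ∧
      cechBetti (Y : Set 𝔼) t (k + 1) ≤ (isolatedSets (k + 1) Y t (k + 3) 1).card +
        (k + 4).choose (k + 2) * (connectedSets Y t (k + 4)).card := by
  induction Y using Finset.strongInduction with
  | H Y ih =>
    by_cases hY : cechConnected (Y : Set 𝔼) t
    · exact cechBetti_bounds_of_cechConnected ht hY k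
    obtain rfl | hne := Y.eq_empty_or_nonempty
    · have hle := cechBetti_le_choose (∅ : Finset 𝔼) t k
      rw [Finset.card_empty, Nat.choose_eq_zero_of_lt (by omega)] at hle
      have hem : isolatedSets (k + 1) (∅ : Finset 𝔼) t (k + 3) 1 = ∅ := by
        refine Finset.eq_empty_of_forall_notMem fun S hS => ?_
        obtain ⟨h1, h2, -⟩ := mem_isolatedSets.1 hS
        rw [Finset.subset_empty.1 h1, Finset.card_empty] at h2
        omega
      rw [hem, Finset.card_empty]
      omega
    obtain ⟨D, D', hD, hD', hDD, hdis⟩ := exists_split ht hne hY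
    obtain ⟨h1, h2⟩ := ih D hD
    obtain ⟨h3, h4⟩ := ih D' hD'
    have h5 := Nat.mul_le_mul_left ((k + 4).choose (k + 2))
      (card_connectedSets_add_le ht hDD hdis (k + 4))
    rw [mul_add] at h5
    rw [cechBetti_union hDD hdis, card_isolatedSets_union ht hDD hdis]
    omega

end Cech

end CechBound

end

/-- Upper and lower bounds for the Betti number of the tail Čech complex
(Lemma `upper.lower.betti`). -/
theorem stmt7 (d k : ℕ) (hd : 2 ≤ d) (hk1 : 1 ≤ k) (hkd : k ≤ d - 1)
    (X : Finset (EuclideanSpace ℝ (Fin d))) (R : ℝ) (hR : 0 < R)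
    (t : ℝ) (ht0 : 0 < t) (ht1 : t ≤ 1) :
    Jcount k {x : EuclideanSpace ℝ (Fin d) | x ∈ X ∧ R ≤ ‖x‖} t (k + 2) 1 ≤
        cechBetti {x : EuclideanSpace ℝ (Fin d) | x ∈ X ∧ R ≤ ‖x‖} t k ∧
      cechBetti {x : EuclideanSpace ℝ (Fin d) | x ∈ X ∧ R ≤ ‖x‖} t k ≤
        Jcount k {x : EuclideanSpace ℝ (Fin d) | x ∈ X ∧ R ≤ ‖x‖} t (k + 2) 1 +
          Nat.choose (k + 3) (k + 1) *
            Lcount {x : EuclideanSpace ℝ (Fin d) | x ∈ X ∧ R ≤ ‖x‖} t (k + 3) := by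
  obtain ⟨m, rfl⟩ : ∃ m, k = m + 1 := ⟨k - 1, by omega⟩
  classical
  have hset : {x : EuclideanSpace ℝ (Fin d) | x ∈ X ∧ R ≤ ‖x‖} =
      ((X.filter fun x => R ≤ ‖x‖ : Finset (EuclideanSpace ℝ (Fin d))) :
        Set (EuclideanSpace ℝ (Fin d))) := by
    ext x
    simp
  rw [hset, CechBound.Jcount_coe, CechBound.Lcount_coe]
  exact CechBound.cechBetti_bounds ht0 m _
end

section
/- Let ψ : [0,∞) → [0,∞) be non-decreasing, unbounded, and regularly varying at infinity with index τ > 0 (i.e. ψ(rt)/ψ(r) → t^τ as r → ∞ for every t > 0), and let ψ^←(x) := inf{y : ψ(y) ≥ x} be its left-continuous inverse. If (R_n) is a sequence of positive numbers with ψ(R_n)/log n → 1 as n → ∞, then R_n/ψ^←(log n) → 1 as n → ∞. In particular this holds when R_n = ψ^←(log n + b log log n) for some b > 0, and also when f(x) = C exp(−ψ(‖x‖)) is a probability density on ℝ^d and n f(R_n) → λ for some λ ∈ (0,∞). -/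
open MeasureTheory Filter Topology CategoryTheory AlgebraicTopology
open scoped InnerProductSpace ENNReal NNReal

theorem psiInv_le {ψ : ℝ → ℝ} {x y : ℝ} (hy : 0 ≤ y) (h : x ≤ ψ y) : psiInv ψ x ≤ y :=
  csInf_le ⟨0, fun _ hz => hz.1⟩ ⟨hy, h⟩

theorem le_psiInv {ψ : ℝ → ℝ} (hmono : MonotoneOn ψ (Set.Ici 0))
    (hunb : Tendsto ψ atTop atTop) {x y : ℝ} (hy : 0 ≤ y) (h : ψ y < x) : y ≤ psiInv ψ x := by
  obtain ⟨z, hz0, hz⟩ := ((eventually_ge_atTop 0).and (hunb.eventually_ge_atTop x)).exists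
  exact le_csInf ⟨z, hz0, hz⟩ fun w hw =>
    (hmono.reflect_lt hy hw.1 (h.trans_le hw.2)).le

theorem tendsto_psiInv_atTop {ψ : ℝ → ℝ} (hmono : MonotoneOn ψ (Set.Ici 0))
    (hunb : Tendsto ψ atTop atTop) : Tendsto (psiInv ψ) atTop atTop := by
  refine tendsto_atTop.2 fun M => ?_
  filter_upwards [eventually_gt_atTop (ψ (max M 0))] with x hx
  exact (le_max_left _ _).trans (le_psiInv hmono hunb (le_max_right _ _) hx)

/-- Multiplicative squeeze: a ratio that is eventually at most every `s > 1` and at least every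
`s ∈ (0, 1)` tends to `1`. -/
theorem tendsto_one_of_forall_eventually {ι : Type*} {l : Filter ι} {f : ι → ℝ}
    (hup : ∀ s > (1 : ℝ), ∀ᶠ i in l, f i ≤ s)
    (hlow : ∀ s > (0 : ℝ), s < 1 → ∀ᶠ i in l, s ≤ f i) : Tendsto f l (𝓝 1) := by
  refine tendsto_order.2 ⟨fun a ha => ?_, fun a ha => ?_⟩
  · obtain ⟨s, hs, hs1⟩ := exists_between (max_lt ha zero_lt_one)
    filter_upwards [hlow s ((le_max_right _ _).trans_lt hs) hs1] with i hi
    exact ((le_max_left _ _).trans_lt hs).trans_le hi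
  · obtain ⟨s, hs1, hs⟩ := exists_between ha
    filter_upwards [hup s hs1] with i hi
    exact hi.trans_lt hs

/-- If `ψ` is regularly varying of positive index, then `ψ (R) ∼ x → ∞` implies
`R ∼ ψ^← (x)`. -/
theorem tendsto_div_psiInv {τ : ℝ} (hτ : 0 < τ) {ψ : ℝ → ℝ}
    (hmono : MonotoneOn ψ (Set.Ici 0)) (hunb : Tendsto ψ atTop atTop)
    (hRV : ∀ s > (0:ℝ), Tendsto (fun r => ψ (r * s) / ψ r) atTop (𝓝 (s ^ τ)))
    {ι : Type*} {l : Filter ι} {R x : ι → ℝ} (hR : ∀ᶠ i in l, 0 ≤ R i)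
    (hx : Tendsto x l atTop) (hRx : Tendsto (fun i => ψ (R i) / x i) l (𝓝 1)) :
    Tendsto (fun i => R i / psiInv ψ (x i)) l (𝓝 1) := by
  have hψR : Tendsto (fun i => ψ (R i)) l atTop := by
    refine (hRx.pos_mul_atTop one_pos hx).congr' ?_
    filter_upwards [hx.eventually_gt_atTop 0] with i hi
    exact div_mul_cancel₀ _ hi.ne'
  have hRtop : Tendsto R l atTop := by
    refine tendsto_atTop.2 fun M => ?_
    filter_upwards [hR, hψR.eventually_gt_atTop (ψ (max M 0))] with i hi0 hi
    exact (le_max_left _ _).trans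
      (hmono.reflect_lt (Set.mem_Ici.2 (le_max_right _ _)) hi0 hi).le
  have hratio : ∀ s > (0:ℝ), Tendsto (fun i => ψ (R i * s) / x i) l (𝓝 (s ^ τ)) := by
    intro s hs
    have h := ((hRV s hs).comp hRtop).mul hRx
    rw [mul_one] at h
    refine h.congr' ?_
    filter_upwards [hψR.eventually_gt_atTop 0] with i hi
    exact div_mul_div_cancel₀ hi.ne'
  have hinv : Tendsto (fun i => psiInv ψ (x i) / R i) l (𝓝 1) := by
    refine tendsto_one_of_forall_eventually (fun s hs => ?_) (fun s hs hs1 => ?_)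
    · have hs0 : 0 < s := one_pos.trans hs
      filter_upwards [(hratio s hs0).eventually_const_lt (Real.one_lt_rpow hs hτ),
        hx.eventually_gt_atTop 0, hRtop.eventually_gt_atTop 0] with i hi hxi hRi
      rw [div_le_iff₀' hRi]
      exact psiInv_le (by positivity) ((one_lt_div hxi).1 hi).le
    · filter_upwards [(hratio s hs).eventually_lt_const (Real.rpow_lt_one hs.le hs1 hτ),
        hx.eventually_gt_atTop 0, hRtop.eventually_gt_atTop 0] with i hi hxi hRi
      rw [le_div_iff₀' hRi]
      exact le_psiInv hmono hunb (by positivity) ((div_lt_one hxi).1 hi)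
  simpa using hinv.inv₀ one_ne_zero

/-- The generalized inverse of a regularly varying function is an asymptotic right inverse:
`ψ (ψ^← (x)) ∼ x`. -/
theorem tendsto_map_psiInv_div {τ : ℝ} {ψ : ℝ → ℝ}
    (hmono : MonotoneOn ψ (Set.Ici 0)) (hunb : Tendsto ψ atTop atTop)
    (hRV : ∀ s > (0:ℝ), Tendsto (fun r => ψ (r * s) / ψ r) atTop (𝓝 (s ^ τ))) :
    Tendsto (fun x => ψ (psiInv ψ x) / x) atTop (𝓝 1) := by
  have hq := tendsto_psiInv_atTop hmono hunb
  have hcont : Tendsto (fun s : ℝ => s ^ τ) (𝓝 1) (𝓝 1) := by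
    simpa using (Real.continuousAt_rpow_const 1 τ (Or.inl one_ne_zero)).tendsto
  have hinv : Tendsto (fun x => x / ψ (psiInv ψ x)) atTop (𝓝 1) := by
    refine tendsto_one_of_forall_eventually (fun c hc => ?_) (fun c _ hc1 => ?_)
    · have hev := (hcont.eventually_lt_const hc).filter_mono
        (nhdsWithin_le_nhds (s := Set.Ioi 1))
      obtain ⟨s, hsc, hs⟩ := (hev.and self_mem_nhdsWithin).exists
      have hs1 : (1:ℝ) < s := hs
      filter_upwards [((hRV s (one_pos.trans hs1)).comp hq).eventually_lt_const hsc,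
        hq.eventually_gt_atTop 0, (hunb.comp hq).eventually_gt_atTop 0] with x hx hqx hψx
      refine le_trans ?_ hx.le
      refine div_le_div_of_nonneg_right ?_ hψx.le
      by_contra! hlt
      have := le_psiInv hmono hunb (by positivity) hlt
      nlinarith
    · have hev := (hcont.eventually_const_lt hc1).filter_mono
        (nhdsWithin_le_nhds (s := Set.Iio 1))
      obtain ⟨s, ⟨hsc, hs⟩, hs0⟩ := ((hev.and self_mem_nhdsWithin).and
        (nhdsWithin_le_nhds (eventually_gt_nhds zero_lt_one))).exists
      have hs1 : s < (1:ℝ) := hs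
      filter_upwards [((hRV s hs0).comp hq).eventually_const_lt hsc,
        hq.eventually_gt_atTop 0, (hunb.comp hq).eventually_gt_atTop 0] with x hx hqx hψx
      refine hx.le.trans ?_
      refine div_le_div_of_nonneg_right ?_ hψx.le
      by_contra! hlt
      have := psiInv_le (mul_pos hqx hs0).le hlt.le
      nlinarith
  simpa using hinv.inv₀ one_ne_zero

/-- If `ψ(R_n) ∼ log n` then `R_n ∼ ψ^←(log n)`, together with the two particular cases
used in the paper. -/
theorem stmt9 (τ : ℝ) (hτ : 0 < τ) (ψ : ℝ → ℝ)
    (hψmono : MonotoneOn ψ (Set.Ici 0)) (hψunb : Tendsto ψ atTop atTop)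
    (hψRV : ∀ s > (0:ℝ), Tendsto (fun r => ψ (r * s) / ψ r) atTop (𝓝 (s ^ τ))) :
    (∀ R : ℕ → ℝ, (∀ n, 0 < R n) →
      Tendsto (fun n : ℕ => ψ (R n) / Real.log n) atTop (𝓝 1) →
      Tendsto (fun n : ℕ => R n / psiInv ψ (Real.log n)) atTop (𝓝 1)) ∧
    (∀ b > (0:ℝ),
      Tendsto (fun n : ℕ => psiInv ψ (Real.log n + b * Real.log (Real.log n)) /
        psiInv ψ (Real.log n)) atTop (𝓝 1)) ∧
    ∀ C > (0:ℝ), ∀ lam > (0:ℝ), ∀ R : ℕ → ℝ, (∀ n, 0 < R n) →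
      Tendsto (fun n : ℕ => (n : ℝ) * (C * Real.exp (-ψ (R n)))) atTop (𝓝 lam) →
      Tendsto (fun n : ℕ => R n / psiInv ψ (Real.log n)) atTop (𝓝 1) := by
  have hlog : Tendsto (fun n : ℕ => Real.log n) atTop atTop :=
    Real.tendsto_log_atTop.comp tendsto_natCast_atTop_atTop
  have hmain : ∀ R : ℕ → ℝ, (∀ᶠ n in atTop, 0 ≤ R n) →
      Tendsto (fun n : ℕ => ψ (R n) / Real.log n) atTop (𝓝 1) →
      Tendsto (fun n : ℕ => R n / psiInv ψ (Real.log n)) atTop (𝓝 1) := fun R hR hRlog =>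
    tendsto_div_psiInv hτ hψmono hψunb hψRV hR hlog hRlog
  refine ⟨fun R hR => hmain R (Eventually.of_forall fun n => (hR n).le), fun b hb => ?_,
    fun C hC lam hlam R hR hlim => ?_⟩
  · have hloglog : Tendsto (fun n : ℕ => Real.log (Real.log n)) atTop atTop :=
      Real.tendsto_log_atTop.comp hlog
    have hx : Tendsto (fun n : ℕ => Real.log n + b * Real.log (Real.log n)) atTop atTop :=
      hlog.atTop_add_atTop (hloglog.const_mul_atTop hb)
    have hxlog : Tendsto (fun n : ℕ =>
        (Real.log n + b * Real.log (Real.log n)) / Real.log n) atTop (𝓝 1) := by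
      have h := ((Real.isLittleO_log_id_atTop.tendsto_div_nhds_zero.comp hlog).const_mul
        b).const_add 1
      rw [mul_zero, add_zero] at h
      refine h.congr' ?_
      filter_upwards [hlog.eventually_gt_atTop 0] with n hn
      simp only [Function.comp_apply, id_eq]
      field_simp
    refine hmain _
      (((tendsto_psiInv_atTop hψmono hψunb).comp hx).eventually_ge_atTop 0) ?_
    have h := ((tendsto_map_psiInv_div hψmono hψunb hψRV).comp hx).mul hxlog
    rw [mul_one] at h
    refine h.congr' ?_
    filter_upwards [hx.eventually_gt_atTop 0] with n hn
    exact div_mul_div_cancel₀ hn.ne'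
  · refine hmain R (Eventually.of_forall fun n => (hR n).le) ?_
    have h := (((Real.continuousAt_log hlam.ne').tendsto.comp hlim).sub_const
      (Real.log C)).div_atTop hlog
    have h' := h.const_sub 1
    rw [sub_zero] at h'
    refine h'.congr' ?_
    filter_upwards [hlog.eventually_gt_atTop 0, eventually_gt_atTop 0] with n hn hn0
    have hn' : (n : ℝ) ≠ 0 := by exact_mod_cast hn0.ne'
    simp only [Function.comp_apply]
    rw [Real.log_mul hn' (by positivity), Real.log_mul hC.ne' (Real.exp_pos _).ne',
      Real.log_exp]
    field_simp
    ring
end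

section
/- Let d ≥ 1, i ≥ 2, and t ∈ (0,1]. Then the Lebesgue measure of the set {(y_1,…,y_{i−1}) ∈ (ℝ^d)^{i−1} : the point set {0, y_1, …, y_{i−1}} is t-connected} is at most i^{i−2} (ω_d t^d)^{i−1}; in particular it is at most i^{i−2} ω_d^{i−1}. -/
open MeasureTheory Filter Topology CategoryTheory AlgebraicTopology
open scoped InnerProductSpace ENNReal NNReal

/-- For `m` free vertices and `k` roots, the number of forests on the `m + k` vertices in which
every tree contains exactly one root: `k * (m + k) ^ (m - 1)`. -/
def rootedForestCount : ℕ → ℕ → ℕ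
  | 0, _ => 1
  | m + 1, k => k * (m + 1 + k) ^ m

lemma sum_choose_mul_index_mul_pow (m N : ℕ) :
    ∑ l ∈ Finset.range (m + 1), (m.choose l : ℤ) * (l * (N : ℤ) ^ (l - 1)) =
      m * ((N : ℤ) + 1) ^ (m - 1) := by
  cases m with
  | zero => simp
  | succ m =>
    rw [Finset.sum_range_succ', add_pow]
    simp only [Nat.add_sub_cancel, one_pow, mul_one, Nat.cast_zero, zero_mul, mul_zero, add_zero,
      Finset.mul_sum]
    refine Finset.sum_congr rfl fun l _ => ?_
    have h : ((m + 1 : ℕ) : ℤ) * (m.choose l : ℤ) = ((m + 1).choose (l + 1) : ℤ) * (l + 1 : ℕ) := by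
      exact_mod_cast Nat.add_one_mul_choose_eq m l
    linear_combination (-(N : ℤ) ^ l) * h

lemma rootedForestCount_cast (m k : ℕ) :
    (rootedForestCount m k : ℤ) =
      ((m + k : ℕ) : ℤ) ^ m - m * ((m + k : ℕ) : ℤ) ^ (m - 1) := by
  cases m with
  | zero => simp [rootedForestCount]
  | succ m =>
    simp only [rootedForestCount, Nat.add_sub_cancel]
    push_cast
    ring

lemma sum_choose_mul_rootedForestCount (m k : ℕ) :
    ∑ j ∈ Finset.range (m + 1), m.choose j * rootedForestCount (m - j) (k + j) =
      rootedForestCount m (k + 1) := by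
  zify
  rw [← Finset.sum_range_reflect, rootedForestCount_cast]
  have h : ∀ l ∈ Finset.range (m + 1),
      (m.choose (m + 1 - 1 - l) : ℤ) *
        (rootedForestCount (m - (m + 1 - 1 - l)) (k + (m + 1 - 1 - l)) : ℤ) =
      ((m + k : ℕ) : ℤ) ^ l * 1 ^ (m - l) * (m.choose l : ℤ) -
        (m.choose l : ℤ) * (l * ((m + k : ℕ) : ℤ) ^ (l - 1)) := by
    intro l hl
    have hl' : l ≤ m := by simpa [Nat.lt_succ_iff] using hl
    rw [rootedForestCount_cast, Nat.add_sub_cancel, Nat.choose_symm hl', Nat.sub_sub_self hl',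
      show l + (k + (m - l)) = m + k by omega]
    ring
  rw [Finset.sum_congr rfl h, Finset.sum_sub_distrib, ← add_pow, sum_choose_mul_index_mul_pow]
  push_cast
  ring

section Linked

variable {ι E : Type*} [DecidableEq ι] [PseudoMetricSpace E]

/-- Every free index in `T` is joined to some root in `R` by a chain of indices of `R ∪ T` along
which `y` makes jumps shorter than `t`, expressed through cuts: every nonempty set of free
indices has a short edge to its complement. -/
def LinkedToRoots (t : ℝ) (R T : Finset ι) (y : ι → E) : Prop :=
  ∀ S : Finset ι, S ⊆ T → S.Nonempty → ∃ i ∈ S, ∃ j ∈ (R ∪ T) \ S, dist (y i) (y j) < t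

lemma LinkedToRoots.peel {t : ℝ} {R T N : Finset ι} {y : ι → E} {r : ι}
    (h : LinkedToRoots t R T y) (hN : ∀ i ∈ T, dist (y i) (y r) < t → i ∈ N) :
    LinkedToRoots t (R.erase r ∪ N) (T \ N) y := by
  intro S hS hne
  obtain ⟨i, hi, j, hj, hij⟩ := h S (hS.trans Finset.sdiff_subset) hne
  refine ⟨i, hi, j, ?_, hij⟩
  have hiT := Finset.mem_sdiff.1 (hS hi)
  have hjr : j ≠ r := by
    rintro rfl
    exact hiT.2 (hN i hiT.1 hij)
  simp only [Finset.mem_sdiff, Finset.mem_union, Finset.mem_erase] at hj ⊢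
  tauto

lemma not_linkedToRoots_empty {t : ℝ} {T : Finset ι} (hT : T.Nonempty) (y : ι → E) :
    ¬ LinkedToRoots t ∅ T y := by
  intro h
  obtain ⟨i, -, j, hj, -⟩ := h T subset_rfl hT
  simp at hj

lemma isOpen_setOf_linkedToRoots [Finite ι] (t : ℝ) (R T : Finset ι) :
    IsOpen {y : ι → E | LinkedToRoots t R T y} := by
  simp only [LinkedToRoots, Set.ofPred_forall]
  refine isOpen_iInter_of_finite fun S => isOpen_iInter_of_finite fun _ =>
    isOpen_iInter_of_finite fun _ => ?_
  have : {y : ι → E | ∃ i ∈ S, ∃ j ∈ (R ∪ T) \ S, dist (y i) (y j) < t} =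
      ⋃ i ∈ S, ⋃ j ∈ (R ∪ T) \ S, {y | dist (y i) (y j) < t} := by
    ext y
    simp only [Set.mem_iUnion, Set.mem_ofPred_eq, exists_prop]
  rw [this]
  exact isOpen_biUnion fun i _ => isOpen_biUnion fun j _ =>
    isOpen_lt (by fun_prop) continuous_const

variable [Fintype ι] [MeasurableSpace E] [OpensMeasurableSpace E]
  (μ : Measure E) [SigmaFinite μ]

lemma lmarginal_indicator_near_le {t : ℝ} {v : ℝ≥0∞} (hv : ∀ x, μ (Metric.ball x t) ≤ v)
    (N : Finset ι) {r : ι} (hr : r ∉ N) (x : ι → E) :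
    (∫⋯∫⁻_N, {y : ι → E | ∀ i ∈ N, dist (y i) (y r) < t}.indicator 1 ∂fun _ => μ) x ≤
      v ^ N.card := by
  have h : ∀ z : N → E,
      {y : ι → E | ∀ i ∈ N, dist (y i) (y r) < t}.indicator (1 : (ι → E) → ℝ≥0∞)
        (Function.updateFinset x N z) =
      (Set.univ.pi fun _ : N => Metric.ball (x r) t).indicator 1 z := by
    intro z
    refine Set.indicator_eq_indicator ?_ rfl
    simp +contextual [Function.updateFinset, hr]
  rw [lmarginal, lintegral_congr h,
    lintegral_indicator_one (MeasurableSet.univ_pi fun _ => Metric.isOpen_ball.measurableSet),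
    Measure.pi_pi]
  refine (Finset.prod_le_prod' fun _ _ => hv (x r)).trans ?_
  simp

lemma lmarginal_peel_le {t : ℝ} {v c : ℝ≥0∞} (hv : ∀ x, μ (Metric.ball x t) ≤ v)
    {N T : Finset ι} (hN : N ⊆ T) {r : ι} (hr : r ∉ T) {B : Set (ι → E)} (hB : MeasurableSet B)
    (hA : MeasurableSet {y : ι → E | ∀ i ∈ N, dist (y i) (y r) < t})
    (hc : ∀ x, (∫⋯∫⁻_(T \ N), B.indicator 1 ∂fun _ => μ) x ≤ c) (x : ι → E) :
    (∫⋯∫⁻_T, (fun y => {y : ι → E | ∀ i ∈ N, dist (y i) (y r) < t}.indicator 1 y *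
      B.indicator 1 y) ∂fun _ => μ) x ≤ v ^ N.card * c := by
  set A : Set (ι → E) := {y : ι → E | ∀ i ∈ N, dist (y i) (y r) < t} with hAdef
  have hAm : Measurable (A.indicator (1 : (ι → E) → ℝ≥0∞)) := measurable_one.indicator hA
  have hBm : Measurable (B.indicator (1 : (ι → E) → ℝ≥0∞)) := measurable_one.indicator hB
  have hinner : (∫⋯∫⁻_(T \ N), (fun y => A.indicator 1 y * B.indicator 1 y) ∂fun _ => μ) ≤
      fun y => A.indicator 1 y * c := by
    intro y
    have hupd : ∀ z : (T \ N : Finset ι) → E,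
        A.indicator (1 : (ι → E) → ℝ≥0∞) (Function.updateFinset y (T \ N) z) =
          A.indicator 1 y := by
      intro z
      refine Set.indicator_eq_indicator ?_ rfl
      simp +contextual [hAdef, Function.updateFinset, hr]
    have hne : A.indicator (1 : (ι → E) → ℝ≥0∞) y ≠ ⊤ := by
      by_cases hy : y ∈ A <;> simp [hy]
    simp only [lmarginal, hupd]
    rw [lintegral_const_mul' _ _ hne]
    gcongr
    exact hc y
  have hconst : (∫⋯∫⁻_N, (fun y => A.indicator 1 y * c) ∂fun _ => μ) x =
      (∫⋯∫⁻_N, A.indicator 1 ∂fun _ => μ) x * c :=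
    lintegral_mul_const _ (hAm.comp measurable_updateFinset)
  conv_lhs => rw [← Finset.union_sdiff_of_subset hN]
  rw [lmarginal_union _ (fun y => A.indicator 1 y * B.indicator 1 y) (hAm.mul hBm)
    Finset.disjoint_sdiff]
  refine (lmarginal_mono hinner x).trans ?_
  rw [hconst]
  gcongr
  exact lmarginal_indicator_near_le μ hv N (fun h => hr (hN h)) x

lemma lmarginal_linkedToRoots_le [SecondCountableTopology E] {t : ℝ} {v : ℝ≥0∞}
    (hv : ∀ x, μ (Metric.ball x t) ≤ v) (R T : Finset ι) (hRT : Disjoint R T) (x : ι → E) :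
    (∫⋯∫⁻_T, {y : ι → E | LinkedToRoots t R T y}.indicator 1 ∂fun _ => μ) x ≤
      rootedForestCount T.card R.card * v ^ T.card := by
  have hempty : ∀ (R : Finset ι) (x : ι → E),
      (∫⋯∫⁻_∅, {y : ι → E | LinkedToRoots t R ∅ y}.indicator 1 ∂fun _ => μ) x ≤
        rootedForestCount (∅ : Finset ι).card R.card * v ^ (∅ : Finset ι).card := by
    intro R x
    rw [lmarginal_empty, Finset.card_empty, rootedForestCount, pow_zero, Nat.cast_one, one_mul]
    exact Set.indicator_apply_le' (fun _ => le_refl 1) fun _ => zero_le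
  induction hn : R.card + T.card generalizing R T x with
  | zero =>
    obtain rfl : T = ∅ := Finset.card_eq_zero.1 (by omega)
    exact hempty R x
  | succ n ih =>
    rcases T.eq_empty_or_nonempty with rfl | hT
    · exact hempty R x
    rcases R.eq_empty_or_nonempty with rfl | ⟨r, hr⟩
    · simp [not_linkedToRoots_empty hT, lmarginal]
    have hrT : r ∉ T := Finset.disjoint_left.1 hRT hr
    have hRcard : (R.erase r).card + 1 = R.card := Finset.card_erase_add_one hr
    let A : Finset ι → Set (ι → E) := fun N => {y | ∀ i ∈ N, dist (y i) (y r) < t}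
    let B : Finset ι → Set (ι → E) :=
      fun N => {y | LinkedToRoots t (R.erase r ∪ N) (T \ N) y}
    have hA : ∀ N, MeasurableSet (A N) := by
      intro N
      simp only [A, Set.ofPred_forall]
      exact N.measurableSet_biInter fun i _ => measurableSet_lt (by fun_prop) measurable_const
    have hB : ∀ N, MeasurableSet (B N) :=
      fun N => (isOpen_setOf_linkedToRoots _ _ _).measurableSet
    have hmeas : ∀ N, Measurable fun y : ι → E =>
        ((A N).indicator 1 y * (B N).indicator 1 y : ℝ≥0∞) :=
      fun N => (measurable_one.indicator (hA N)).mul (measurable_one.indicator (hB N))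
    have hcover : {y : ι → E | LinkedToRoots t R T y}.indicator (1 : (ι → E) → ℝ≥0∞) ≤
        fun y => ∑ N ∈ T.powerset, (A N).indicator 1 y * (B N).indicator 1 y := by
      intro y
      refine Set.indicator_apply_le' (fun hy => ?_) fun _ => zero_le
      let N := T.filter fun i => dist (y i) (y r) < t
      have hyA : y ∈ A N := fun i hi => (Finset.mem_filter.1 hi).2
      have hyB : y ∈ B N :=
        LinkedToRoots.peel hy fun i hi hd => Finset.mem_filter.2 ⟨hi, hd⟩
      have := Finset.single_le_sum (f := fun N => ((A N).indicator 1 y * (B N).indicator 1 y : ℝ≥0∞))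
        (fun _ _ => zero_le) (Finset.mem_powerset.2 (T.filter_subset _) : N ∈ T.powerset)
      simpa [hyA, hyB] using this
    have hterm : ∀ N ∈ T.powerset,
        (∫⋯∫⁻_T, (fun y => (A N).indicator 1 y * (B N).indicator 1 y) ∂fun _ => μ) x ≤
          (rootedForestCount (T.card - N.card) ((R.erase r).card + N.card) : ℕ) *
            v ^ T.card := by
      intro N hN
      rw [Finset.mem_powerset] at hN
      have hdisj : Disjoint (R.erase r) N := (hRT.mono_left (R.erase_subset r)).mono_right hN
      have hNcard := Finset.card_le_card hN
      have hsd := Finset.card_sdiff_of_subset hN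
      have hun := Finset.card_union_of_disjoint hdisj
      refine (lmarginal_peel_le μ hv hN hrT (hB N) (hA N) (fun x => ih (R.erase r ∪ N) (T \ N)
        ?_ x (by omega)) x).trans_eq ?_
      · exact Finset.disjoint_union_left.2
          ⟨(hRT.mono_left (R.erase_subset r)).mono_right Finset.sdiff_subset,
            Finset.disjoint_sdiff⟩
      · rw [hsd, hun, mul_left_comm, ← pow_add, Nat.add_sub_cancel' hNcard]
    calc _ ≤ (∫⋯∫⁻_T, (fun y => ∑ N ∈ T.powerset, (A N).indicator 1 y * (B N).indicator 1 y)
            ∂fun _ => μ) x := lmarginal_mono hcover x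
      _ = ∑ N ∈ T.powerset,
          (∫⋯∫⁻_T, (fun y => (A N).indicator 1 y * (B N).indicator 1 y) ∂fun _ => μ) x :=
        lintegral_finsetSum _ fun N _ => (hmeas N).comp measurable_updateFinset
      _ ≤ _ := Finset.sum_le_sum hterm
      _ = _ := by
        rw [← Finset.sum_mul, ← Nat.cast_sum, Finset.sum_powerset_apply_card
          (fun j => rootedForestCount (T.card - j) ((R.erase r).card + j)), ← hRcard,
          ← sum_choose_mul_rootedForestCount]
        simp only [smul_eq_mul]

end Linked

lemma linkedToRoots_of_cechConnected {d m : ℕ} {t : ℝ} (ht : 0 < t)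
    {y : Fin m → EuclideanSpace ℝ (Fin d)} (h : cechConnected (insert 0 (Set.range y)) t) :
    LinkedToRoots t {0} (Finset.univ.image Fin.succ)
      (Fin.cons 0 y : Fin (m + 1) → EuclideanSpace ℝ (Fin d)) := by
  intro S hS hne
  set z : Fin (m + 1) → EuclideanSpace ℝ (Fin d) := Fin.cons 0 y with hz
  have hrange : insert 0 (Set.range y) = Set.range z := (Fin.range_cons 0 y).symm
  have hbody : cechBody (Set.range z) t = ⋃ i, Metric.ball (z i) (t / 2) := by
    simp [cechBody, ballsAround]
  rw [cechConnected, hrange, hbody] at h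
  have hmem : ∀ i, z i ∈ Metric.ball (z i) (t / 2) := fun i => Metric.mem_ball_self (half_pos ht)
  have hzero : (0 : Fin (m + 1)) ∉ S := by
    intro h0
    simpa using hS h0
  obtain ⟨i₀, hi₀⟩ := hne
  obtain ⟨p, -, hpU, hpV⟩ := h.isPreconnected
    (⋃ i ∈ S, Metric.ball (z i) (t / 2)) (⋃ i ∉ S, Metric.ball (z i) (t / 2))
    (isOpen_biUnion fun _ _ => Metric.isOpen_ball) (isOpen_biUnion fun _ _ => Metric.isOpen_ball)
    (by
      intro p hp
      obtain ⟨i, hi⟩ := Set.mem_iUnion.1 hp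
      by_cases hiS : i ∈ S
      · exact Or.inl (Set.mem_biUnion hiS hi)
      · exact Or.inr (Set.mem_biUnion (s := {i | i ∉ S}) hiS hi))
    ⟨z i₀, Set.mem_iUnion.2 ⟨i₀, hmem i₀⟩, Set.mem_biUnion hi₀ (hmem i₀)⟩
    ⟨z 0, Set.mem_iUnion.2 ⟨0, hmem 0⟩, Set.mem_biUnion (s := {i | i ∉ S}) hzero (hmem 0)⟩
  simp only [Set.mem_iUnion, Metric.mem_ball, exists_prop] at hpU hpV
  obtain ⟨i, hiS, hi⟩ := hpU
  obtain ⟨j, hjS, hj⟩ := hpV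
  refine ⟨i, hiS, j, Finset.mem_sdiff.2 ⟨?_, hjS⟩, ?_⟩
  · cases j using Fin.cases <;> simp
  · have := dist_triangle_left (z i) (z j) p
    linarith

lemma volume_cechConnected_le (d m : ℕ) {t : ℝ} (ht : 0 < t) :
    volume {y : Fin m → EuclideanSpace ℝ (Fin d) | cechConnected (insert 0 (Set.range y)) t} ≤
      rootedForestCount m 1 * ENNReal.ofReal (unitBallVol d * t ^ d) ^ m := by
  let T : Finset (Fin (m + 1)) := Finset.univ.image Fin.succ
  let L : Set (Fin (m + 1) → EuclideanSpace ℝ (Fin d)) := {z | LinkedToRoots t {0} T z}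
  let L' : Set (Fin m → EuclideanSpace ℝ (Fin d)) := {y | Fin.cons 0 y ∈ L}
  have hL' : MeasurableSet L' :=
    ((isOpen_setOf_linkedToRoots t {0} T).preimage
      (f := fun y : Fin m → EuclideanSpace ℝ (Fin d) => (Fin.cons 0 y : Fin (m + 1) → _))
      (by fun_prop)).measurableSet
  have hball : ∀ x : EuclideanSpace ℝ (Fin d),
      volume (Metric.ball x t) ≤ ENNReal.ofReal (unitBallVol d * t ^ d) := by
    intro x
    rw [Measure.addHaar_ball_of_pos _ _ ht, mul_comm (unitBallVol d),
      ENNReal.ofReal_mul (by positivity), unitBallVol,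
      ENNReal.ofReal_toReal Metric.isBounded_ball.measure_lt_top.ne, finrank_euclideanSpace_fin]
  have hT : T.card = m := by
    rw [Finset.card_image_of_injective _ (Fin.succ_injective m), Finset.card_fin]
  have hmarg := lmarginal_linkedToRoots_le volume hball {0} T
    (by simp [T]) (0 : Fin (m + 1) → EuclideanSpace ℝ (Fin d))
  rw [hT, Finset.card_singleton] at hmarg
  refine le_trans ?_ hmarg
  calc _ ≤ volume L' := measure_mono fun y hy => linkedToRoots_of_cechConnected ht hy
    _ = ∫⁻ y, L'.indicator 1 y := (lintegral_indicator_one hL').symm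
    _ = (∫⋯∫⁻_Finset.univ, L'.indicator 1 ∂fun _ => volume)
          (fun _ => (0 : EuclideanSpace ℝ (Fin d))) := by
        rw [lmarginal_univ]; rfl
    _ = (∫⋯∫⁻_T, (fun z => L'.indicator 1 (z ∘ Fin.succ)) ∂fun _ => volume) 0 :=
        (lmarginal_image (X := fun _ : Fin (m + 1) => EuclideanSpace ℝ (Fin d))
          (μ := fun _ => volume) (Fin.succ_injective m) Finset.univ
          (measurable_one.indicator hL') 0).symm
    _ = _ := by
      refine lintegral_congr fun w => Set.indicator_eq_indicator ?_ rfl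
      set z := Function.updateFinset (0 : Fin (m + 1) → EuclideanSpace ℝ (Fin d)) T w
      have hz : (Fin.cons 0 (z ∘ Fin.succ) : Fin (m + 1) → EuclideanSpace ℝ (Fin d)) = z := by
        ext1 i
        cases i using Fin.cases with
        | zero => simp [z, Function.updateFinset, T]
        | succ i => rfl
      change (Fin.cons 0 (z ∘ Fin.succ) : Fin (m + 1) → EuclideanSpace ℝ (Fin d)) ∈ L ↔ z ∈ L
      rw [hz]

/-- The Lebesgue measure of the set of `(i-1)`-tuples `y` for which `{0, y₁, …, y_{i-1}}`
is `t`-connected is at most `i^{i-2} (ω_d t^d)^{i-1} ≤ i^{i-2} ω_d^{i-1}`. -/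
theorem stmt15 (d i : ℕ) (hd : 1 ≤ d) (hi : 2 ≤ i) (t : ℝ) (ht0 : 0 < t) (ht1 : t ≤ 1) :
    volume {y : Fin (i - 1) → EuclideanSpace ℝ (Fin d) |
        cechConnected (insert 0 (Set.range y)) t} ≤
      ENNReal.ofReal ((i : ℝ) ^ (i - 2) * (unitBallVol d * t ^ d) ^ (i - 1)) ∧
    volume {y : Fin (i - 1) → EuclideanSpace ℝ (Fin d) |
        cechConnected (insert 0 (Set.range y)) t} ≤
      ENNReal.ofReal ((i : ℝ) ^ (i - 2) * unitBallVol d ^ (i - 1)) := by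
  obtain ⟨m, rfl⟩ : ∃ m, i = m + 2 := ⟨i - 2, by omega⟩
  have hω : 0 ≤ unitBallVol d := ENNReal.toReal_nonneg
  have key := volume_cechConnected_le d (m + 1) ht0
  have hcount : rootedForestCount (m + 1) 1 = (m + 2) ^ m := by
    simp [rootedForestCount]
  have hfirst : volume {y : Fin (m + 2 - 1) → EuclideanSpace ℝ (Fin d) |
      cechConnected (insert 0 (Set.range y)) t} ≤
      ENNReal.ofReal (((m + 2 : ℕ) : ℝ) ^ (m + 2 - 2) *
        (unitBallVol d * t ^ d) ^ (m + 2 - 1)) := by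
    refine key.trans_eq ?_
    rw [hcount, ENNReal.ofReal_mul (p := ((m + 2 : ℕ) : ℝ) ^ (m + 2 - 2)) (by positivity),
      ← Nat.cast_pow, ENNReal.ofReal_natCast, ENNReal.ofReal_pow (by positivity)]
    rfl
  refine ⟨hfirst, hfirst.trans (ENNReal.ofReal_le_ofReal ?_)⟩
  gcongr
  exact mul_le_of_le_one_right hω (pow_le_one₀ ht0.le ht1)
end

section
/- Assume the exponential-tail setup with density f(x) = C exp(−ψ(‖x‖)), fix d ≥ 2 and k ∈ {1,…,d−1}, and let R_n = ψ^←(log n + b log log n) for some 0 < b < (d−τ)/(τ(k+2)). Set η_n := n^{k+2} a(R_n) R_n^{d−1} f(R_n)^{k+2}. Then for every ζ' > 0 with (d−τ)/τ − b(k+2) − ζ' > 0 there is a constant c > 0 such that η_n ≥ c (log n)^{(d−τ)/τ − b(k+2) − ζ'} for all sufficiently large n. In particular, η_n ≥ c (log n)^ζ for some ζ > 0 and all large n. -/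
open MeasureTheory Filter Topology CategoryTheory AlgebraicTopology
open scoped InnerProductSpace ENNReal NNReal

section RegularVariation

variable {ψ : ℝ → ℝ} {τ : ℝ}

/-- A strictly increasing positive function whose dyadic ratios tend to `2 ^ τ` with `τ > 0`
tends to infinity. -/
theorem tendsto_atTop_of_dyadic_ratio (hτ : 0 < τ) (hmono : StrictMonoOn ψ (Set.Ioi 0))
    (hpos : ∀ x > (0 : ℝ), 0 < ψ x)
    (hratio : Tendsto (fun r => ψ (r * 2) / ψ r) atTop (𝓝 ((2 : ℝ) ^ τ))) :
    Tendsto ψ atTop atTop := by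
  obtain ⟨q, hq1, hq2⟩ := exists_between (Real.one_lt_rpow one_lt_two hτ)
  obtain ⟨r₀, hr₀⟩ := eventually_atTop.1
    ((hratio.eventually (lt_mem_nhds hq2)).and (eventually_gt_atTop 0))
  have hr₀pos : 0 < r₀ := (hr₀ r₀ le_rfl).2
  have hstep : ∀ r ≥ r₀, q * ψ r ≤ ψ (r * 2) := fun r hr =>
    ((lt_div_iff₀ (hpos r (hr₀ r hr).2)).1 (hr₀ r hr).1).le
  have hiter : ∀ n : ℕ, q ^ n * ψ r₀ ≤ ψ (r₀ * 2 ^ n) := by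
    intro n
    induction n with
    | zero => simp
    | succ n ih =>
      have hge : r₀ ≤ r₀ * 2 ^ n := le_mul_of_one_le_right hr₀pos.le (one_le_pow₀ one_le_two)
      calc q ^ (n + 1) * ψ r₀ = q * (q ^ n * ψ r₀) := by ring
        _ ≤ q * ψ (r₀ * 2 ^ n) := by gcongr
        _ ≤ ψ (r₀ * 2 ^ n * 2) := hstep _ hge
        _ = ψ (r₀ * 2 ^ (n + 1)) := by ring_nf
  refine tendsto_atTop.2 fun B => ?_
  obtain ⟨n, hn⟩ := ((tendsto_pow_atTop_atTop_of_one_lt hq1).atTop_mul_const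
    (hpos r₀ hr₀pos)).eventually_ge_atTop B |>.exists
  filter_upwards [eventually_ge_atTop (r₀ * 2 ^ n)] with r hr
  have hp : 0 < r₀ * 2 ^ n := by positivity
  exact hn.trans ((hiter n).trans (hmono.monotoneOn hp (hp.trans_le hr) hr))

/-- An increasing positive function whose dyadic ratios tend to `2 ^ τ` is dominated by
every power function of exponent larger than `τ`. -/
theorem exists_le_rpow_of_dyadic_ratio {σ : ℝ} (hσ : τ < σ) (hσ0 : 0 < σ)
    (hmono : StrictMonoOn ψ (Set.Ioi 0)) (hpos : ∀ x > (0 : ℝ), 0 < ψ x)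
    (hratio : Tendsto (fun r => ψ (r * 2) / ψ r) atTop (𝓝 ((2 : ℝ) ^ τ))) :
    ∃ K > (0 : ℝ), ∀ᶠ r in atTop, ψ r ≤ K * r ^ σ := by
  obtain ⟨r₀, hr₀⟩ := eventually_atTop.1
    ((hratio.eventually (gt_mem_nhds (Real.rpow_lt_rpow_of_exponent_lt one_lt_two hσ))).and
      (eventually_gt_atTop 0))
  have hr₀pos : 0 < r₀ := (hr₀ r₀ le_rfl).2
  have hstep : ∀ r ≥ r₀, ψ (r * 2) ≤ 2 ^ σ * ψ r := fun r hr =>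
    ((div_lt_iff₀ (hpos r (hr₀ r hr).2)).1 (hr₀ r hr).1).le
  set K := ψ (r₀ * 2) / r₀ ^ σ with hK
  have hpow : 0 < r₀ ^ σ := Real.rpow_pos_of_pos hr₀pos σ
  have hKpos : 0 < K := div_pos (hpos _ (by positivity)) hpow
  have hdyadic : ∀ n : ℕ, ∀ r, r₀ ≤ r → r ≤ r₀ * 2 ^ (n + 1) → ψ r ≤ K * r ^ σ := by
    have hbase : ∀ r, r₀ ≤ r → r ≤ r₀ * 2 → ψ r ≤ K * r ^ σ := fun r h1 h2 =>
      calc ψ r ≤ ψ (r₀ * 2) :=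
            hmono.monotoneOn (hr₀pos.trans_le h1) (by simpa using hr₀pos) h2
        _ = K * r₀ ^ σ := by rw [hK]; field_simp
        _ ≤ K * r ^ σ := by gcongr
    intro n
    induction n with
    | zero => simpa using hbase
    | succ n ih =>
      intro r h1 h2
      rcases le_total r (r₀ * 2) with h | h
      · exact hbase r h1 h
      · have hhalf : r₀ ≤ r / 2 := by linarith
        have hhalf' : r / 2 ≤ r₀ * 2 ^ (n + 1) := by rw [pow_succ] at h2; linarith
        calc ψ r = ψ (r / 2 * 2) := by congr 1; ring
          _ ≤ 2 ^ σ * ψ (r / 2) := hstep _ hhalf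
          _ ≤ 2 ^ σ * (K * (r / 2) ^ σ) := by gcongr; exact ih _ hhalf hhalf'
          _ = K * ((2 : ℝ) ^ σ * (r / 2) ^ σ) := by ring
          _ = K * r ^ σ := by
            rw [← Real.mul_rpow zero_le_two (by linarith)]; congr 2; ring
  refine ⟨K, hKpos, ?_⟩
  filter_upwards [eventually_ge_atTop r₀] with r hr
  obtain ⟨n, hn⟩ := ((tendsto_pow_atTop_atTop_of_one_lt one_lt_two).const_mul_atTop
    hr₀pos).eventually_ge_atTop r |>.exists
  refine hdyadic n r hr (hn.trans ?_)
  gcongr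
  · exact one_le_two
  · exact n.le_succ

/-- For large arguments the generalized inverse of a continuous strictly increasing unbounded
function is a genuine right inverse. -/
theorem eventually_psiInv (hmono : StrictMonoOn ψ (Set.Ioi 0))
    (hcont : ContinuousOn ψ (Set.Ioi 0)) (htop : Tendsto ψ atTop atTop) :
    ∀ᶠ x in atTop, ψ (psiInv ψ x) = x := by
  filter_upwards [eventually_gt_atTop (ψ 0), eventually_ge_atTop (ψ 1)] with x hx0 hx1
  obtain ⟨M, hMx, hM1⟩ := ((htop.eventually_ge_atTop x).and (eventually_ge_atTop 1)).exists
  obtain ⟨y, hy, rfl⟩ := intermediate_value_Icc hM1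
    (hcont.mono fun z hz => zero_lt_one.trans_le hz.1) ⟨hx1, hMx⟩
  have hypos : 0 < y := zero_lt_one.trans_le hy.1
  have hset : {z : ℝ | 0 ≤ z ∧ ψ y ≤ ψ z} = Set.Ici y := by
    ext z
    constructor
    · rintro ⟨hz0, hz⟩
      rcases hz0.eq_or_lt with rfl | hzpos
      · exact absurd hz hx0.not_ge
      · exact (hmono.le_iff_le hypos hzpos).1 hz
    · intro hz
      have hzpos : 0 < z := hypos.trans_le hz
      exact ⟨hzpos.le, hmono.monotoneOn hypos hzpos hz⟩
  rw [psiInv, hset, csInf_Ici]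

/-- The generalized inverse of a strictly increasing unbounded function tends to infinity. -/
theorem tendsto_psiInv_atTop_s17 (hmono : StrictMonoOn ψ (Set.Ioi 0))
    (htop : Tendsto ψ atTop atTop) : Tendsto (psiInv ψ) atTop atTop := by
  refine tendsto_atTop.2 fun B => ?_
  filter_upwards [eventually_gt_atTop (ψ 0), eventually_gt_atTop (ψ (max B 1))] with x hx0 hxB
  obtain ⟨M, hMx, hM0⟩ := ((htop.eventually_ge_atTop x).and (eventually_ge_atTop 0)).exists
  refine le_csInf ⟨M, hM0, hMx⟩ ?_
  rintro z ⟨hz0, hz⟩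
  rcases hz0.eq_or_lt with rfl | hzpos
  · exact absurd hz hx0.not_ge
  · by_contra! hlt
    have hm : (0 : ℝ) < max B 1 := by positivity
    exact absurd (hmono.monotoneOn hzpos hm (hlt.le.trans (le_max_left _ _))) (by linarith)

/-- If the derivative of a nonnegative function is eventually antitone, then
`ψ' r ≤ 2 ψ r / r` for large `r`. -/
theorem eventually_deriv_mul_le (hnonneg : ∀ x ≥ (0 : ℝ), 0 ≤ ψ x)
    (hdiff : ∀ x > (0 : ℝ), DifferentiableAt ℝ ψ x)
    (hanti : ∃ x₀ > (0 : ℝ), AntitoneOn (deriv ψ) (Set.Ici x₀)) :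
    ∀ᶠ r in atTop, deriv ψ r * r ≤ 2 * ψ r := by
  obtain ⟨x₀, hx₀, hanti⟩ := hanti
  filter_upwards [eventually_ge_atTop (2 * x₀)] with r hr
  have hrpos : 0 < r := by linarith
  obtain ⟨ξ, ⟨hξ1, hξ2⟩, hξ⟩ := exists_deriv_eq_slope ψ (half_lt_self hrpos)
    (fun z hz => (hdiff z ((half_pos hrpos).trans_le hz.1)).continuousAt.continuousWithinAt)
    (fun z hz => (hdiff z ((half_pos hrpos).trans hz.1)).differentiableWithinAt)
  have hle : deriv ψ r ≤ deriv ψ ξ :=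
    hanti (show x₀ ≤ ξ by linarith) (show x₀ ≤ r by linarith) hξ2.le
  rw [hξ, le_div_iff₀ (by linarith)] at hle
  have := hnonneg (r / 2) (by linarith)
  linarith

/-- Lower bound for `r ^ (d - 1) / ψ' r` along the generalized inverse of `ψ`. -/
theorem exists_rpow_le_inv_deriv_psiInv {σ : ℝ} {d : ℕ} (hd : 1 ≤ d) (hτ : 0 < τ) (hσ : τ < σ)
    (hnonneg : ∀ x ≥ (0 : ℝ), 0 ≤ ψ x) (hdiff : ∀ x > (0 : ℝ), DifferentiableAt ℝ ψ x)
    (hderiv : ∀ x > (0 : ℝ), 0 < deriv ψ x)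
    (hanti : ∃ x₀ > (0 : ℝ), AntitoneOn (deriv ψ) (Set.Ici x₀))
    (hratio : Tendsto (fun r => ψ (r * 2) / ψ r) atTop (𝓝 ((2 : ℝ) ^ τ))) :
    ∃ c > (0 : ℝ), ∀ᶠ x in atTop, ψ (psiInv ψ x) = x ∧
      c * x ^ (d / σ - 1) ≤ (deriv ψ (psiInv ψ x))⁻¹ * psiInv ψ x ^ (d - 1) := by
  have hcont : ContinuousOn ψ (Set.Ioi 0) := fun x hx =>
    (hdiff x hx).continuousAt.continuousWithinAt
  have hmono : StrictMonoOn ψ (Set.Ioi 0) := by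
    refine strictMonoOn_of_deriv_pos (convex_Ioi 0) hcont fun x hx => hderiv x ?_
    rwa [interior_Ioi] at hx
  have hpos : ∀ x > (0 : ℝ), 0 < ψ x := fun x hx =>
    (hnonneg (x / 2) (by linarith)).trans_lt
      (hmono (half_pos hx) hx (half_lt_self hx))
  have htop := tendsto_atTop_of_dyadic_ratio hτ hmono hpos hratio
  have hσ0 : 0 < σ := hτ.trans hσ
  obtain ⟨K, hK, hle⟩ := exists_le_rpow_of_dyadic_ratio hσ hσ0 hmono hpos hratio
  have hinv := tendsto_psiInv_atTop_s17 hmono htop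
  refine ⟨2⁻¹ * (K ^ ((d : ℝ) / σ))⁻¹, by positivity, ?_⟩
  filter_upwards [eventually_psiInv hmono hcont htop, hinv.eventually hle,
    hinv.eventually (eventually_deriv_mul_le hnonneg hdiff hanti),
    hinv.eventually_gt_atTop 0, eventually_gt_atTop 0] with x hx hxle hxd hr hx0
  refine ⟨hx, ?_⟩
  rw [hx] at hxle hxd
  set r := psiInv ψ x
  have hD := hderiv r hr
  have hxpow : x ^ ((d : ℝ) / σ) ≤ K ^ ((d : ℝ) / σ) * r ^ d := by
    calc x ^ ((d : ℝ) / σ) ≤ (K * r ^ σ) ^ ((d : ℝ) / σ) := by gcongr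
      _ = K ^ ((d : ℝ) / σ) * r ^ d := by
        rw [Real.mul_rpow hK.le (by positivity), ← Real.rpow_mul hr.le,
          mul_div_cancel₀ _ hσ0.ne', Real.rpow_natCast]
  have hdinv : r / (2 * x) ≤ (deriv ψ r)⁻¹ := by
    rw [div_le_iff₀ (by positivity), inv_mul_eq_div, le_div_iff₀ hD]
    linarith
  calc 2⁻¹ * (K ^ ((d : ℝ) / σ))⁻¹ * x ^ ((d : ℝ) / σ - 1)
      = (2 * x)⁻¹ * ((K ^ ((d : ℝ) / σ))⁻¹ * x ^ ((d : ℝ) / σ)) := by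
        rw [Real.rpow_sub_one hx0.ne']; field_simp
    _ ≤ (2 * x)⁻¹ * r ^ d := by
        gcongr
        rw [inv_mul_le_iff₀ (by positivity)]
        exact hxpow
    _ = r / (2 * x) * r ^ (d - 1) := by
        obtain ⟨e, rfl⟩ := Nat.exists_eq_add_of_le' hd
        rw [Nat.add_sub_cancel, pow_succ]; ring
    _ ≤ (deriv ψ r)⁻¹ * r ^ (d - 1) := by gcongr

end RegularVariation

/-- Logarithmic lower bound for the normalizing sequence `η_n` in the exponential-tail
crackle regime. -/
theorem stmt17 (d k : ℕ) (hd : 2 ≤ d) (hk1 : 1 ≤ k) (hkd : k ≤ d - 1)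
    (τ : ℝ) (hτ0 : 0 < τ) (hτ1 : τ ≤ 1)
    (ψ : ℝ → ℝ) (hψnonneg : ∀ x ≥ (0:ℝ), 0 ≤ ψ x)
    (hψdiff : ∀ x > (0:ℝ), DifferentiableAt ℝ ψ x)
    (hψdiff2 : ∀ x > (0:ℝ), DifferentiableAt ℝ (deriv ψ) x)
    (hψRV : ∀ s > (0:ℝ), Tendsto (fun r => ψ (r * s) / ψ r) atTop (𝓝 (s ^ τ)))
    (hψ'pos : ∀ x > (0:ℝ), 0 < deriv ψ x)
    (hψ'mono : ∃ x₀ > (0:ℝ), AntitoneOn (deriv ψ) (Set.Ici x₀))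
    (a : ℝ → ℝ) (ha : ∀ z, a z = (deriv ψ z)⁻¹)
    (haRV : ∀ s > (0:ℝ), Tendsto (fun r => a (r * s) / a r) atTop (𝓝 (s ^ (1 - τ))))
    (Cf : ℝ) (hCf : 0 < Cf)
    (b : ℝ) (hb0 : 0 < b) (hb1 : b < ((d : ℝ) - τ) / (τ * (k + 2)))
    (R : ℕ → ℝ) (hR : ∀ n, R n = psiInv ψ (Real.log n + b * Real.log (Real.log n)))
    (η : ℕ → ℝ) (hη : ∀ n, η n =
      (n : ℝ) ^ (k + 2) * a (R n) * R n ^ (d - 1) * (Cf * Real.exp (-ψ (R n))) ^ (k + 2)) :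
    (∀ ζ' > (0:ℝ), 0 < ((d : ℝ) - τ) / τ - b * (k + 2) - ζ' →
      ∃ c > (0:ℝ), ∀ᶠ n : ℕ in atTop,
        c * Real.log n ^ (((d : ℝ) - τ) / τ - b * (k + 2) - ζ') ≤ η n) ∧
    ∃ ζ > (0:ℝ), ∃ c > (0:ℝ), ∀ᶠ n : ℕ in atTop, c * Real.log n ^ ζ ≤ η n := by
  have hdR : (2 : ℝ) ≤ d := by exact_mod_cast hd
  have main : ∀ ζ' > (0:ℝ), 0 < ((d : ℝ) - τ) / τ - b * (k + 2) - ζ' →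
      ∃ c > (0:ℝ), ∀ᶠ n : ℕ in atTop,
        c * Real.log n ^ (((d : ℝ) - τ) / τ - b * (k + 2) - ζ') ≤ η n := by
    intro ζ' hζ' hexp
    have hbk : 0 < b * (k + 2) := by positivity
    have hdτ : ((d : ℝ) - τ) / τ = d / τ - 1 := by field_simp
    have hden : 0 < d / τ - ζ' := by linarith
    have hσ : τ < d / (d / τ - ζ') := by
      rw [lt_div_iff₀ hden, mul_sub, mul_div_cancel₀ _ hτ0.ne']
      nlinarith
    obtain ⟨c, hc, hev⟩ := exists_rpow_le_inv_deriv_psiInv (d := d) (by lia) hτ0 hσ hψnonneg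
      hψdiff hψ'pos hψ'mono (hψRV 2 two_pos)
    have hlog : Tendsto (fun n : ℕ => Real.log n) atTop atTop :=
      Real.tendsto_log_atTop.comp tendsto_natCast_atTop_atTop
    have hloglog := Real.tendsto_log_atTop.comp hlog
    have hx : Tendsto (fun n : ℕ => Real.log n + b * Real.log (Real.log n)) atTop atTop :=
      hlog.atTop_add_atTop (hloglog.const_mul_atTop hb0)
    refine ⟨c * Cf ^ (k + 2), by positivity, ?_⟩
    filter_upwards [hx.eventually hev, hlog.eventually_gt_atTop 0,
      hloglog.eventually_ge_atTop 0, eventually_gt_atTop 0] with n hn hL hLL hn0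
    obtain ⟨hψR, hlow⟩ := hn
    rw [← hR n] at hψR hlow
    rw [div_div_cancel₀ (by positivity)] at hlow
    have hn0' : (0 : ℝ) < n := by exact_mod_cast hn0
    set L := Real.log n with hLdef
    have hweight : (n : ℝ) ^ (k + 2) * (Cf * Real.exp (-ψ (R n))) ^ (k + 2)
        = Cf ^ (k + 2) * L ^ (-(b * (k + 2))) := by
      have hexpn : Real.exp (-ψ (R n)) = (n : ℝ)⁻¹ * L ^ (-b) := by
        rw [hψR, neg_add, Real.exp_add, Real.exp_neg, hLdef, Real.exp_log hn0',
          Real.rpow_def_of_pos hL]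
        congr 2
        ring
      have hpow : L ^ (-(b * (k + 2))) = (L ^ (-b)) ^ (k + 2) := by
        rw [← Real.rpow_natCast, ← Real.rpow_mul hL.le]
        push_cast
        congr 1
        ring
      rw [hexpn, hpow, ← mul_pow, ← mul_pow]
      congr 1
      field_simp
    have hmonoL : L ^ ((d : ℝ) / τ - ζ' - 1)
        ≤ (L + b * Real.log L) ^ ((d : ℝ) / τ - ζ' - 1) := by
      refine Real.rpow_le_rpow hL.le ?_ (by linarith)
      exact le_add_of_nonneg_right (mul_nonneg hb0.le hLL)
    calc c * Cf ^ (k + 2) * L ^ (((d : ℝ) - τ) / τ - b * (k + 2) - ζ')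
        = Cf ^ (k + 2) * L ^ (-(b * (k + 2))) * (c * L ^ ((d : ℝ) / τ - ζ' - 1)) := by
          have hsplit : ((d : ℝ) - τ) / τ - b * (k + 2) - ζ'
              = -(b * (k + 2)) + (d / τ - ζ' - 1) := by rw [hdτ]; ring
          rw [hsplit, Real.rpow_add hL]
          ring
      _ ≤ Cf ^ (k + 2) * L ^ (-(b * (k + 2))) *
            ((deriv ψ (R n))⁻¹ * R n ^ (d - 1)) := by
          refine mul_le_mul_of_nonneg_left ?_ (by positivity)
          exact (mul_le_mul_of_nonneg_left hmonoL hc.le).trans hlow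
      _ = η n := by
          rw [hη, ← hweight, ha]
          ring
  refine ⟨main, ?_⟩
  have hE : 0 < ((d : ℝ) - τ) / τ - b * (k + 2) := by
    rw [lt_div_iff₀ (by positivity)] at hb1
    rw [sub_pos, lt_div_iff₀ hτ0]
    linarith
  exact ⟨_, by linarith, main _ (half_pos hE) (by linarith)⟩
end
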